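/- Let m, n ≥ 1 and v > 0, and let W_v := {X ∈ [0,1]^{m×n} : ‖qX‖ < |q|^{-v} for infinitely many q ∈ ℤ^m \ {0}}. Then the Hausdorff dimension of W_v equals (m-1)n + (m+n)/(v+1) when v > m/n, and equals mn when v ≤ m/n. In particular, for m = n = 1 and v > 1, the set of α ∈ [0,1] with ‖qα‖ < q^{-v} for infinitely many q ∈ ℕ has Hausdorff dimension 2/(v+1). -/

import Mathlib

open MeasureTheory Set

/-- `nint ξ = min {|ξ - p| : p ∈ ℤ}`, the distance from `ξ` to the nearest integer. -/
noncomputable def nint (ξ : ℝ) : ℝ := ⨅ p : ℤ, |ξ - (p : ℝ)|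

/-- `‖u‖ = max_j dist(u_j, ℤ)` for `u ∈ ℝⁿ`. -/
noncomputable def supNint {n : ℕ} (u : Fin n → ℝ) : ℝ := ⨆ j, nint (u j)

/-- `|q| = max_i |q_i|`, the supremum norm of an integer vector. -/
def supNorm {m : ℕ} (q : Fin m → ℤ) : ℕ := Finset.univ.sup fun i => (q i).natAbs

/-- The set `W_v` of `v`-approximable `m × n` matrices in the unit cube:
`‖qX‖ < |q|^{-v}` for infinitely many nonzero `q ∈ ℤᵐ`. -/
noncomputable def Wv (m n : ℕ) (v : ℝ) : Set (Fin m → Fin n → ℝ) :=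
  {X | (∀ i j, X i j ∈ Icc (0 : ℝ) 1) ∧
    {q : Fin m → ℤ | q ≠ 0 ∧
      supNint (fun j => ∑ i, (q i : ℝ) * X i j) < (supNorm q : ℝ) ^ (-v)}.Infinite}

section

open Metric Filter Topology
open scoped ENNReal NNReal

/-- Vitali covering by balls that need not be centred at the covered points. -/
lemma exists_disjoint_closedBall_covering {n : ℕ} {ι : Type*} (x : ι → Fin n → ℝ) (ρ : ι → ℝ)
    (hρ : ∀ i, 0 < ρ i) (T : Set ι)
    (hfull : ∀ᵐ y : Fin n → ℝ, ∀ σ > 0, ∃ i ∈ T, ρ i < σ ∧ y ∈ closedBall (x i) (ρ i))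
    {U : Set (Fin n → ℝ)} (hU : IsOpen U) :
    ∃ u ⊆ T, u.Countable ∧ u.PairwiseDisjoint (fun i => closedBall (x i) (ρ i)) ∧
      (∀ i ∈ u, closedBall (x i) (ρ i) ⊆ U) ∧
      volume (U \ ⋃ i ∈ u, closedBall (x i) (ρ i)) = 0 := by
  set G := {y : Fin n → ℝ | ∀ σ > 0, ∃ i ∈ T, ρ i < σ ∧ y ∈ closedBall (x i) (ρ i)} with hG
  obtain ⟨u, huT, huc, hud, hu0⟩ := Vitali.exists_disjoint_covering_ae
    (volume : Measure (Fin n → ℝ)) (U ∩ G)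
    {a : ι × (Fin n → ℝ) | a.1 ∈ T ∧ a.2 ∈ closedBall (x a.1) (ρ a.1) ∧
      closedBall (x a.1) (ρ a.1) ⊆ U} (6 ^ n) (fun a => 2 * ρ a.1) (fun a => a.2)
    (fun a => closedBall (x a.1) (ρ a.1))
    (by
      rintro ⟨i, y⟩ ⟨-, hy, -⟩
      refine closedBall_subset_closedBall' ?_
      rw [mem_closedBall, dist_comm] at hy
      simp only at hy ⊢
      linarith)
    (by
      rintro ⟨i, y⟩ -
      have h := hρ i
      simp only
      rw [Real.volume_pi_closedBall _ (by positivity), Real.volume_pi_closedBall _ h.le]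
      have : ((6 ^ n : ℝ≥0) : ℝ≥0∞) = ENNReal.ofReal (6 ^ n) := by
        rw [ENNReal.ofReal_pow (by norm_num)]; simp
      rw [this, ← ENNReal.ofReal_mul (by positivity)]
      refine ENNReal.ofReal_le_ofReal (le_of_eq ?_)
      rw [Fintype.card_fin, ← mul_pow]
      ring)
    (by
      rintro ⟨i, y⟩ -
      exact ⟨x i, ball_subset_interior_closedBall (mem_ball_self (hρ i))⟩)
    (fun a _ => isClosed_closedBall)
    (by
      rintro y ⟨hyU, hyG⟩ ε hε
      obtain ⟨δ, hδ, hδU⟩ := Metric.isOpen_iff.1 hU y hyU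
      obtain ⟨i, hiT, hi, hyi⟩ := hyG (min (ε / 2) (δ / 2)) (by positivity)
      have h1 := hi.trans_le (min_le_left _ _)
      have h2 := hi.trans_le (min_le_right _ _)
      refine ⟨(i, y), ⟨hiT, hyi, fun z hz => hδU ?_⟩, by simp only; linarith, rfl⟩
      rw [mem_closedBall] at hz hyi
      rw [mem_ball]
      have := dist_triangle_right z y (x i)
      simp only at hz hyi
      linarith)
  refine ⟨Prod.fst '' u, ?_, huc.image _, ?_, ?_, ?_⟩
  · rintro _ ⟨a, ha, rfl⟩
    exact (huT ha).1
  · rintro _ ⟨a, ha, rfl⟩ _ ⟨b, hb, rfl⟩ hab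
    exact hud ha hb (fun h => hab (by rw [h]))
  · rintro _ ⟨a, ha, rfl⟩
    exact (huT ha).2.2
  · have hcompl : volume (Gᶜ) = 0 := hfull
    refine measure_mono_null (t := ((U ∩ G) \ ⋃ a ∈ u, closedBall (x a.1) (ρ a.1)) ∪ Gᶜ) ?_
      (measure_union_null hu0 hcompl)
    rintro y ⟨hyU, hy⟩
    by_cases hyG : y ∈ G
    · refine Or.inl ⟨⟨hyU, hyG⟩, ?_⟩
      simpa using hy
    · exact Or.inr hyG

lemma volume_closedBall_inter_ge {n : ℕ} {x c : Fin n → ℝ} {ρ R : ℝ} (hR : 0 < R) (hρ : R < ρ)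
    (hne : (closedBall x R ∩ closedBall c ρ).Nonempty) :
    ENNReal.ofReal (R ^ n) ≤ volume (closedBall c ρ ∩ closedBall x (3 * R)) := by
  obtain ⟨y, hyx, hyc⟩ := hne
  rw [mem_closedBall] at hyx hyc
  have hρ0 : 0 < ρ := hR.trans hρ
  set l := R / (2 * ρ) with hl
  have hl0 : 0 < l := by positivity
  have hl1 : l < 1 := by rw [hl, div_lt_one (by positivity)]; linarith
  have hlρ : l * ρ = R / 2 := by rw [hl]; field_simp
  set z := AffineMap.lineMap y c l with hz
  have hzc : dist z c ≤ ρ - R / 2 := by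
    rw [hz, dist_lineMap_right, Real.norm_of_nonneg (by linarith)]
    nlinarith
  have hzy : dist z y ≤ R / 2 := by
    rw [hz, dist_lineMap_left, Real.norm_of_nonneg hl0.le]
    nlinarith
  have : volume (closedBall z (R / 2)) = ENNReal.ofReal (R ^ n) := by
    rw [Real.volume_pi_closedBall _ (by positivity), Fintype.card_fin]
    congr 2; ring
  rw [← this]
  refine measure_mono (subset_inter ?_ ?_)
  · exact closedBall_subset_closedBall' (by linarith)
  · refine closedBall_subset_closedBall' ?_
    have := dist_triangle z y x
    linarith

lemma closedBall_subset_of_inter_nonempty {n : ℕ} {x c : Fin n → ℝ} {ρ R : ℝ}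
    (hne : (closedBall x R ∩ closedBall c ρ).Nonempty) :
    closedBall c ρ ⊆ closedBall x (R + 2 * ρ) := by
  obtain ⟨y, hyx, hyc⟩ := hne
  rw [mem_closedBall] at hyx hyc
  refine closedBall_subset_closedBall' ?_
  have := dist_triangle_left c x y
  linarith

lemma volume_ball_inter_div_le {n : ℕ} {x c : Fin n → ℝ} {r R : ℝ} (hr : 0 < r) (hR : 0 < R) :
    volume (ball c (r / 2) ∩ closedBall x R) / volume (ball c (r / 2)) ≤
      ENNReal.ofReal ((min 1 (2 * R / r)) ^ n) := by
  have hb : volume (ball c (r / 2)) = ENNReal.ofReal (r ^ n) := by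
    rw [Real.volume_pi_ball _ (by positivity), Fintype.card_fin]
    congr 2; ring
  have hQ : volume (closedBall x R) = ENNReal.ofReal ((2 * R) ^ n) := by
    rw [Real.volume_pi_closedBall _ hR.le, Fintype.card_fin]
  refine ENNReal.div_le_of_le_mul ?_
  rw [hb, ← ENNReal.ofReal_mul (by positivity), ← mul_pow, min_mul_of_nonneg _ _ hr.le,
    div_mul_cancel₀ _ hr.ne', one_mul]
  rcases min_cases r (2 * R) with ⟨h, -⟩ | ⟨h, -⟩ <;> rw [h]
  · rw [← hb]; exact measure_mono inter_subset_left
  · rw [← hQ]; exact measure_mono inter_subset_right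

lemma spread_term_le {n : ℕ} {μ : Measure (Fin n → ℝ)} {M : ℝ≥0}
    (hμ : ∀ A, μ A ≤ M * volume A) {s t : ℝ} (hn : 0 < n) (ht : 0 < t) (htn : t < n) (hts : t < s)
    (hsn : s ≤ n) {c x : Fin n → ℝ} {r σ R : ℝ} (hr : 0 < r) (hrσ : r ≤ σ) (hσ : σ ≤ 1)
    (hR : 0 < R) :
    μ (closedBall c (r ^ (s / n))) *
        (volume (ball c (r / 2) ∩ closedBall x R) / volume (ball c (r / 2))) ≤
      ENNReal.ofReal (M * (1 + 4 ^ n * σ ^ (s - t) * R ^ (t - n))) *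
        volume (closedBall c (r ^ (s / n)) ∩ closedBall x (3 * R)) := by
  set ρ := r ^ (s / n) with hρ
  have hρ0 : 0 < ρ := Real.rpow_pos_of_pos hr _
  have hn' : (0 : ℝ) < n := by exact_mod_cast hn
  have hrρ : r ≤ ρ := by
    conv_lhs => rw [← Real.rpow_one r]
    refine Real.rpow_le_rpow_of_exponent_ge hr (hrσ.trans hσ) ?_
    rw [div_le_one hn']; exact hsn
  have hρn : ρ ^ n = r ^ s := by
    rw [hρ, ← Real.rpow_natCast, ← Real.rpow_mul hr.le, div_mul_cancel₀ _ hn'.ne']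
  have hσ0 : 0 < σ := hr.trans_le hrσ
  rcases (ball c (r / 2) ∩ closedBall x R).eq_empty_or_nonempty with he | hne
  · simp [he]
  have hne' : (closedBall x R ∩ closedBall c ρ).Nonempty := by
    obtain ⟨y, hy1, hy2⟩ := hne
    refine ⟨y, hy2, ?_⟩
    rw [mem_ball] at hy1
    rw [mem_closedBall]
    linarith
  rcases le_or_gt ρ R with hρR | hρR
  · have hsub : closedBall c ρ ⊆ closedBall x (3 * R) :=
      (closedBall_subset_of_inter_nonempty hne').trans (closedBall_subset_closedBall (by linarith))
    rw [inter_eq_left.2 hsub]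
    have h1 : volume (ball c (r / 2) ∩ closedBall x R) / volume (ball c (r / 2)) ≤ 1 :=
      (volume_ball_inter_div_le hr hR).trans
        (by
          rw [← ENNReal.ofReal_one]
          exact ENNReal.ofReal_le_ofReal (pow_le_one₀ (by positivity) (min_le_left _ _)))
    calc _ ≤ μ (closedBall c ρ) * 1 := by gcongr
      _ ≤ M * volume (closedBall c ρ) := by rw [mul_one]; exact hμ _
      _ ≤ _ := by
        gcongr
        rw [← ENNReal.ofReal_coe_nnreal]
        refine ENNReal.ofReal_le_ofReal ?_
        have : 0 ≤ (M : ℝ) * (4 ^ n * σ ^ (s - t) * R ^ (t - n)) := by positivity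
        linarith
  · have key : (2 * ρ) ^ n * (min 1 (2 * R / r)) ^ n ≤ 4 ^ n * σ ^ (s - t) * R ^ t := by
      have hθ : (min 1 (2 * R / r)) ^ n ≤ (2 * R / r) ^ t := by
        have h0 : 0 < min 1 (2 * R / r) := by positivity
        rw [← Real.rpow_natCast]
        exact (Real.rpow_le_rpow_of_exponent_ge h0 (min_le_left _ _) htn.le).trans
          (Real.rpow_le_rpow h0.le (min_le_right _ _) ht.le)
      have h2 : (2 : ℝ) ^ t ≤ 2 ^ n := by
        rw [← Real.rpow_natCast]
        exact Real.rpow_le_rpow_of_exponent_le (by norm_num) htn.le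
      calc (2 * ρ) ^ n * (min 1 (2 * R / r)) ^ n ≤ (2 * ρ) ^ n * (2 * R / r) ^ t := by gcongr
        _ = 2 ^ n * 2 ^ t * r ^ (s - t) * R ^ t := by
          rw [mul_pow, hρn, Real.div_rpow (by positivity) hr.le,
            Real.mul_rpow (by norm_num) hR.le, Real.rpow_sub hr]
          ring
        _ ≤ 2 ^ n * 2 ^ n * σ ^ (s - t) * R ^ t := by
          have : r ^ (s - t) ≤ σ ^ (s - t) := Real.rpow_le_rpow hr.le hrσ (by linarith)
          gcongr
        _ = _ := by rw [← mul_pow]; norm_num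
    have hge := volume_closedBall_inter_ge hR hρR hne'
    calc _ ≤ (M * volume (closedBall c ρ)) * ENNReal.ofReal ((min 1 (2 * R / r)) ^ n) := by
          gcongr
          · exact hμ _
          · exact volume_ball_inter_div_le hr hR
      _ = ENNReal.ofReal (M * ((2 * ρ) ^ n * (min 1 (2 * R / r)) ^ n)) := by
          rw [Real.volume_pi_closedBall _ hρ0.le, Fintype.card_fin, mul_assoc,
            ← ENNReal.ofReal_mul (by positivity), ENNReal.ofReal_mul M.coe_nonneg,
            ENNReal.ofReal_coe_nnreal]
      _ ≤ ENNReal.ofReal (M * (1 + 4 ^ n * σ ^ (s - t) * R ^ (t - n)) * R ^ n) := by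
          refine ENNReal.ofReal_le_ofReal ?_
          rw [mul_assoc]
          refine mul_le_mul_of_nonneg_left (key.trans ?_) M.2
          have : R ^ t = R ^ (t - n) * R ^ n := by
            rw [← Real.rpow_natCast, ← Real.rpow_add hR]; ring_nf
          rw [this, add_mul]
          have : 0 < R ^ n := by positivity
          linarith
      _ ≤ _ := by
          rw [ENNReal.ofReal_mul (by positivity)]
          gcongr

/-- The measure obtained from `μ` by concentrating the mass of each ball `closedBall (x i) (ρ i)`
uniformly on `ball (x i) (r i / 2)`. -/
noncomputable def spread {n : ℕ} {ι : Type*} (μ : Measure (Fin n → ℝ)) (x : ι → Fin n → ℝ)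
    (ρ r : ι → ℝ) (F : Finset ι) : Measure (Fin n → ℝ) :=
  ∑ i ∈ F, (μ (closedBall (x i) (ρ i)) / volume (ball (x i) (r i / 2))) •
    volume.restrict (ball (x i) (r i / 2))

section spread

variable {n : ℕ} {ι : Type*} {μ : Measure (Fin n → ℝ)} {x : ι → Fin n → ℝ} {ρ r : ι → ℝ}
  {F : Finset ι}

lemma volume_ball_half_ne_zero (x : ι → Fin n → ℝ) (hr : ∀ i, 0 < r i) (i : ι) :
    volume (ball (x i) (r i / 2)) ≠ 0 :=
  (measure_ball_pos _ _ (by linarith [hr i])).ne'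

lemma spread_apply {Q : Set (Fin n → ℝ)} (hQ : MeasurableSet Q) :
    spread μ x ρ r F Q = ∑ i ∈ F, μ (closedBall (x i) (ρ i)) *
      (volume (ball (x i) (r i / 2) ∩ Q) / volume (ball (x i) (r i / 2))) := by
  simp only [spread, Measure.coe_finsetSum, Finset.sum_apply, Measure.smul_apply, smul_eq_mul]
  refine Finset.sum_congr rfl fun i _ => ?_
  rw [Measure.restrict_apply hQ, inter_comm, ENNReal.mul_comm_div]

lemma spread_univ (hr : ∀ i, 0 < r i) :
    spread μ x ρ r F univ = ∑ i ∈ F, μ (closedBall (x i) (ρ i)) := by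
  rw [spread_apply MeasurableSet.univ]
  refine Finset.sum_congr rfl fun i _ => ?_
  rw [inter_univ, ENNReal.div_self (volume_ball_half_ne_zero x hr i) measure_ball_lt_top.ne,
    mul_one]

lemma spread_compl : spread μ x ρ r F (⋃ i ∈ F, ball (x i) (r i / 2))ᶜ = 0 := by
  have ho : IsOpen (⋃ i ∈ F, ball (x i) (r i / 2)) := isOpen_biUnion fun i _ => isOpen_ball
  rw [spread_apply ho.measurableSet.compl]
  refine Finset.sum_eq_zero fun i hi => ?_
  have : ball (x i) (r i / 2) ∩ (⋃ i ∈ F, ball (x i) (r i / 2))ᶜ = ∅ := by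
    rw [← disjoint_iff_inter_eq_empty, disjoint_compl_right_iff_subset]
    exact subset_biUnion_of_mem (u := fun i => ball (x i) (r i / 2)) (Finset.mem_coe.2 hi)
  rw [this]; simp

lemma spread_le_volume [IsFiniteMeasure μ] (hr : ∀ i, 0 < r i) :
    ∃ M : ℝ≥0, ∀ A, spread μ x ρ r F A ≤ M * volume A := by
  refine ⟨∑ i ∈ F, (μ (closedBall (x i) (ρ i)) / volume (ball (x i) (r i / 2))).toNNReal,
    fun A => ?_⟩
  simp only [spread, Measure.coe_finsetSum, Finset.sum_apply, Measure.smul_apply, smul_eq_mul]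
  rw [ENNReal.ofNNReal_finsetSum, Finset.sum_mul]
  refine Finset.sum_le_sum fun i _ => ?_
  rw [ENNReal.coe_toNNReal (ENNReal.div_ne_top (measure_ne_top _ _)
    (volume_ball_half_ne_zero x hr i))]
  gcongr
  exact Measure.restrict_le_self

lemma spread_closedBall_le_thickened (hd : (F : Set ι).PairwiseDisjoint
    fun i => closedBall (x i) (ρ i)) (hr : ∀ i, 0 < r i) (hrρ : ∀ i ∈ F, r i ≤ ρ i) {σ : ℝ}
    (hρσ : ∀ i ∈ F, ρ i ≤ σ) (y : Fin n → ℝ) (R : ℝ) :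
    spread μ x ρ r F (closedBall y R) ≤ μ (closedBall y (R + 2 * σ)) := by
  classical
  rw [spread_apply measurableSet_closedBall]
  calc _ ≤ ∑ i ∈ F, μ (closedBall (x i) (ρ i) ∩ closedBall y (R + 2 * σ)) := by
        refine Finset.sum_le_sum fun i hi => ?_
        rcases (ball (x i) (r i / 2) ∩ closedBall y R).eq_empty_or_nonempty with he | hne
        · simp [he]
        have hne' : (closedBall y R ∩ closedBall (x i) (ρ i)).Nonempty := by
          obtain ⟨z, hz1, hz2⟩ := hne
          refine ⟨z, hz2, ?_⟩
          rw [mem_ball] at hz1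
          rw [mem_closedBall]
          linarith [hrρ i hi, hr i]
        have hsub : closedBall (x i) (ρ i) ⊆ closedBall y (R + 2 * σ) :=
          (closedBall_subset_of_inter_nonempty hne').trans
            (closedBall_subset_closedBall (by linarith [hρσ i hi]))
        rw [inter_eq_left.2 hsub]
        refine mul_le_of_le_one_right' ?_
        exact ENNReal.div_le_of_le_mul (by rw [one_mul]; exact measure_mono inter_subset_left)
    _ = μ (⋃ i ∈ F, closedBall (x i) (ρ i) ∩ closedBall y (R + 2 * σ)) := by
        rw [measure_biUnion_finset]
        · exact hd.mono fun i => inter_subset_left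
        · exact fun i _ => measurableSet_closedBall.inter measurableSet_closedBall
    _ ≤ _ := measure_mono (iUnion₂_subset fun i _ => inter_subset_right)

lemma spread_closedBall_le_of_small {s t : ℝ} {M : ℝ≥0} (hμ : ∀ A, μ A ≤ M * volume A)
    (hn : 0 < n) (ht : 0 < t) (htn : t < n) (hts : t < s) (hsn : s ≤ n)
    (hρ : ∀ i, ρ i = r i ^ (s / n)) (hd : (F : Set ι).PairwiseDisjoint
    fun i => closedBall (x i) (ρ i)) (hr : ∀ i, 0 < r i) {σ : ℝ} (hrσ : ∀ i ∈ F, r i ≤ σ)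
    (hσ0 : 0 < σ) (hσ : σ ≤ 1) (y : Fin n → ℝ) {R : ℝ} (hR : 0 < R) :
    spread μ x ρ r F (closedBall y R) ≤
      ENNReal.ofReal (M * 6 ^ n * (R ^ (n - t) + 4 ^ n * σ ^ (s - t)) * R ^ t) := by
  classical
  rw [spread_apply measurableSet_closedBall]
  calc _ ≤ ∑ i ∈ F, ENNReal.ofReal (M * (1 + 4 ^ n * σ ^ (s - t) * R ^ (t - n))) *
        volume (closedBall (x i) (ρ i) ∩ closedBall y (3 * R)) := by
        refine Finset.sum_le_sum fun i hi => ?_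
        rw [hρ i]
        exact spread_term_le hμ hn ht htn hts hsn (hr i) (hrσ i hi) hσ hR
    _ = ENNReal.ofReal (M * (1 + 4 ^ n * σ ^ (s - t) * R ^ (t - n))) *
        volume (⋃ i ∈ F, closedBall (x i) (ρ i) ∩ closedBall y (3 * R)) := by
        rw [measure_biUnion_finset, Finset.mul_sum]
        · exact hd.mono fun i => inter_subset_left
        · exact fun i _ => measurableSet_closedBall.inter measurableSet_closedBall
    _ ≤ ENNReal.ofReal (M * (1 + 4 ^ n * σ ^ (s - t) * R ^ (t - n))) *
        volume (closedBall y (3 * R)) := by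
        gcongr
        exact iUnion₂_subset fun i _ => inter_subset_right
    _ = _ := by
        rw [Real.volume_pi_closedBall _ (by positivity), Fintype.card_fin,
          ← ENNReal.ofReal_mul (by positivity)]
        congr 1
        have h1 : R ^ ((n : ℝ) - t) * R ^ t = R ^ n := by
          rw [← Real.rpow_natCast, ← Real.rpow_add hR]; ring_nf
        have h2 : R ^ (t - n) * R ^ n = R ^ t := by
          rw [← Real.rpow_natCast, ← Real.rpow_add hR]; ring_nf
        have h3 : (2 * (3 * R)) ^ n = 6 ^ n * R ^ n := by rw [← mul_pow]; ring
        rw [h3]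
        linear_combination (M : ℝ) * 6 ^ n * 4 ^ n * σ ^ (s - t) * h2 - (M : ℝ) * 6 ^ n * h1

end spread

/-- A finite measure `μ` carried by the open set `U`, of mass larger than `a`, with bounded density,
and giving a closed ball of radius `R` mass at most `c * R ^ t` for some `c < C`. -/
structure FrostmanPair {n : ℕ} (t C : ℝ) (a : ℝ≥0∞) (μ : Measure (Fin n → ℝ))
    (U : Set (Fin n → ℝ)) : Prop where
  isOpen : IsOpen U
  measure_compl : μ Uᶜ = 0
  lt_measure : a < μ univ
  measure_univ_lt_top : μ univ < ∞
  le_volume : ∃ M : ℝ≥0, ∀ A, μ A ≤ M * volume A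
  closedBall_le : ∃ c, 0 < c ∧ c < C ∧
    ∀ y, ∀ R > 0, μ (closedBall y R) ≤ ENNReal.ofReal (c * R ^ t)

lemma exists_small_scale {n : ℕ} {s t δ c σ₀ M : ℝ} (hn : 0 < n) (ht : 0 < t) (htn : t < n)
    (hts : t < s) (hc : 0 < c) (hσ₀ : 0 < σ₀) :
    ∃ σ, 0 < σ ∧ σ ≤ 1 ∧ σ ≤ σ₀ ∧
      M * 6 ^ n * ((2 * σ ^ (s / n) / δ) ^ (n - t) + 4 ^ n * σ ^ (s - t)) ≤ c := by
  have hn' : (0 : ℝ) < n := by exact_mod_cast hn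
  have h1 : ContinuousAt (fun σ : ℝ =>
      M * 6 ^ n * ((2 * σ ^ (s / n) / δ) ^ (n - t) + 4 ^ n * σ ^ (s - t))) 0 := by
    have e1 : 0 ≤ s / n := by have := ht.trans hts; positivity
    have e2 : 0 ≤ n - t := by linarith
    have e3 : 0 ≤ s - t := by linarith
    have c1 : ContinuousAt (fun σ : ℝ => σ ^ (s / n)) 0 := Real.continuousAt_rpow_const _ _ (Or.inr e1)
    have c3 : ContinuousAt (fun σ : ℝ => σ ^ (s - t)) 0 := Real.continuousAt_rpow_const _ _ (Or.inr e3)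
    have c2 : ContinuousAt (fun σ : ℝ => (2 * σ ^ (s / n) / δ) ^ (n - t)) 0 :=
      ((continuousAt_const.mul c1).div_const δ).rpow_const (Or.inr e2)
    exact continuousAt_const.mul (c2.add (continuousAt_const.mul c3))
  have h0 : M * 6 ^ n * ((2 * (0 : ℝ) ^ (s / n) / δ) ^ (n - t) + 4 ^ n * 0 ^ (s - t)) < c := by
    have e1 : s / n ≠ 0 := by have := ht.trans hts; positivity
    have e2 : n - t ≠ 0 := by linarith
    have e3 : s - t ≠ 0 := by linarith
    rw [Real.zero_rpow e1, Real.zero_rpow e3, mul_zero, zero_div, Real.zero_rpow e2]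
    simpa using hc
  have h2 := h1.eventually_lt continuousAt_const h0
  obtain ⟨ε, hε, hball⟩ := Metric.eventually_nhds_iff.1 h2
  refine ⟨min (min (ε / 2) 1) σ₀, by positivity, (min_le_left _ _).trans (min_le_right _ _),
    min_le_right _ _, (hball ?_).le⟩
  rw [Real.dist_0_eq_abs, abs_of_pos (by positivity)]
  have : min (min (ε / 2) 1) σ₀ ≤ ε / 2 := (min_le_left _ _).trans (min_le_left _ _)
  linarith

lemma FrostmanPair.exists_next {n : ℕ} {ι : Type*} {s t C : ℝ} {a : ℝ≥0∞} (hn : 0 < n) (ht : 0 < t)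
    (htn : t < n) (hts : t < s) (hsn : s ≤ n) {x : ι → Fin n → ℝ} {r : ι → ℝ} (hr : ∀ i, 0 < r i)
    (hfull : ∀ᵐ y : Fin n → ℝ, ∀ σ > 0, ∃ i, r i < σ ∧ y ∈ closedBall (x i) (r i ^ (s / n)))
    {μ : Measure (Fin n → ℝ)} {U : Set (Fin n → ℝ)} (h : FrostmanPair t C a μ U) {σ₀ : ℝ}
    (hσ₀ : 0 < σ₀) :
    ∃ μ' U', FrostmanPair t C a μ' U' ∧ IsCompact (closure U') ∧ closure U' ⊆ U ∧
      ∀ y ∈ closure U', ∃ i, r i < σ₀ ∧ y ∈ ball (x i) (r i) := by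
  classical
  obtain ⟨hU, hUc, ha, hfin, ⟨M, hM⟩, c, hc, hcC, hcμ⟩ := h
  have hn' : (0 : ℝ) < n := by exact_mod_cast hn
  have hs : 0 < s := ht.trans hts
  have hsn0 : 0 < s / n := by positivity
  have : IsFiniteMeasure μ := ⟨hfin⟩
  set c' := (c + C) / 2 with hc'
  have hcc' : c < c' := by rw [hc']; linarith
  set δ := (c' / c) ^ (1 / t) - 1 with hδ
  have hδ0 : 0 < δ := by
    have : 1 < (c' / c) ^ (1 / t) :=
      Real.one_lt_rpow ((one_lt_div hc).2 hcc') (by positivity)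
    linarith
  have hδt : c * (1 + δ) ^ t = c' := by
    have hq : 0 ≤ c' / c := by have := hc.trans hcc'; positivity
    rw [hδ, add_sub_cancel, ← Real.rpow_mul hq, one_div_mul_cancel ht.ne', Real.rpow_one]
    field_simp
  obtain ⟨σ, hσ, hσ1, hσσ, hsmall⟩ := exists_small_scale (δ := δ) (M := M) hn ht htn hts
    (hc.trans hcc') hσ₀
  set ρ : ι → ℝ := fun i => r i ^ (s / n) with hρ
  have hρ0 : ∀ i, 0 < ρ i := fun i => Real.rpow_pos_of_pos (hr i) _
  obtain ⟨u, huT, huc, hud, huU, hu0⟩ := exists_disjoint_closedBall_covering x ρ hρ0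
    {i | r i < σ} (by
      filter_upwards [hfull] with y hy ε hε
      obtain ⟨i, hi, hyi⟩ := hy (min σ (ε ^ (n / s))) (by positivity)
      refine ⟨i, hi.trans_le (min_le_left _ _), ?_, hyi⟩
      have h2 := hi.trans_le (min_le_right _ _)
      calc ρ i < (ε ^ (n / s)) ^ (s / n) := Real.rpow_lt_rpow (hr i).le h2 hsn0
        _ = ε := by
          rw [← Real.rpow_mul hε.le, div_mul_div_cancel₀ hs.ne', div_self hn'.ne', Real.rpow_one])
    hU
  have hμabs : ∀ A, volume A = 0 → μ A = 0 := fun A hA =>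
    le_antisymm ((hM A).trans (by rw [hA, mul_zero])) bot_le
  have hμu : a < ∑' i : u, μ (closedBall (x i) (ρ i)) := by
    rw [← measure_biUnion huc hud (fun i _ => measurableSet_closedBall)]
    refine ha.trans_le ?_
    calc μ univ ≤ μ ((⋃ i ∈ u, closedBall (x i) (ρ i)) ∪
          ((U \ ⋃ i ∈ u, closedBall (x i) (ρ i)) ∪ Uᶜ)) := by
          refine measure_mono fun y _ => ?_
          by_cases hy : y ∈ ⋃ i ∈ u, closedBall (x i) (ρ i)
          · exact Or.inl hy
          · by_cases hyU : y ∈ U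
            · exact Or.inr (Or.inl ⟨hyU, hy⟩)
            · exact Or.inr (Or.inr hyU)
      _ ≤ _ := (measure_union_le _ _).trans
          (by rw [measure_union_null (hμabs _ hu0) hUc, add_zero])
  rw [ENNReal.tsum_eq_iSup_sum, lt_iSup_iff] at hμu
  obtain ⟨G, hG⟩ := hμu
  set F : Finset ι := G.map (Function.Embedding.subtype _) with hF
  have hFu : ∀ i ∈ F, i ∈ u := by
    intro i hi
    obtain ⟨j, -, rfl⟩ := Finset.mem_map.1 hi
    exact j.2
  have hFsum : a < ∑ i ∈ F, μ (closedBall (x i) (ρ i)) := by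
    rw [hF, Finset.sum_map]; exact hG
  have hFd : (F : Set ι).PairwiseDisjoint fun i => closedBall (x i) (ρ i) :=
    hud.subset fun i hi => hFu i hi
  have hrσ : ∀ i ∈ F, r i < σ := fun i hi => huT (hFu i hi)
  have hrρ : ∀ i ∈ F, r i ≤ ρ i := by
    intro i hi
    conv_lhs => rw [← Real.rpow_one (r i)]
    refine Real.rpow_le_rpow_of_exponent_ge (hr i) ((hrσ i hi).le.trans hσ1) ?_
    rw [div_le_one hn']; exact hsn
  have hρσ : ∀ i ∈ F, ρ i ≤ σ ^ (s / n) := fun i hi =>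
    Real.rpow_le_rpow (hr i).le (hrσ i hi).le hsn0.le
  have hcl : closure (⋃ i ∈ F, ball (x i) (r i / 2)) ⊆ ⋃ i ∈ F, closedBall (x i) (r i / 2) := by
    refine closure_minimal (iUnion₂_mono fun i _ => ball_subset_closedBall) ?_
    exact F.finite_toSet.isClosed_biUnion fun i _ => isClosed_closedBall
  refine ⟨spread μ x ρ r F, ⋃ i ∈ F, ball (x i) (r i / 2),
    ⟨isOpen_biUnion fun i _ => isOpen_ball, spread_compl, ?_, ?_, spread_le_volume hr,
      c', hc.trans hcc', by rw [hc']; linarith, ?_⟩, ?_, ?_, ?_⟩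
  · rwa [spread_univ hr]
  · rw [spread_univ hr]
    exact ENNReal.sum_lt_top.2 fun i _ => measure_lt_top _ _
  · intro y R hR
    rcases le_or_gt (2 * σ ^ (s / n) / δ) R with hRl | hRs
    · refine (spread_closedBall_le_thickened hFd hr hrρ hρσ y R).trans ?_
      have hle : R + 2 * σ ^ (s / n) ≤ (1 + δ) * R := by
        rw [div_le_iff₀ hδ0] at hRl; linarith
      refine (measure_mono (closedBall_subset_closedBall hle)).trans ?_
      refine (hcμ y _ (by positivity)).trans (ENNReal.ofReal_le_ofReal ?_)
      rw [Real.mul_rpow (by positivity) hR.le, ← mul_assoc, hδt]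
    · refine (spread_closedBall_le_of_small hM hn ht htn hts hsn (fun _ => rfl) hFd hr
        (fun i hi => (hrσ i hi).le) hσ hσ1 y hR).trans (ENNReal.ofReal_le_ofReal ?_)
      refine mul_le_mul_of_nonneg_right (le_trans ?_ hsmall) (by positivity)
      have : R ^ (n - t) ≤ (2 * σ ^ (s / n) / δ) ^ (n - t) :=
        Real.rpow_le_rpow hR.le hRs.le (by linarith)
      gcongr
  · refine IsCompact.of_isClosed_subset ?_ isClosed_closure hcl
    exact F.finite_toSet.isCompact_biUnion fun i _ => isCompact_closedBall _ _
  · refine hcl.trans (iUnion₂_subset fun i hi => ?_)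
    exact (closedBall_subset_closedBall (by linarith [hr i, hrρ i hi])).trans (huU i (hFu i hi))
  · intro y hy
    obtain ⟨i, hi, hyi⟩ := mem_iUnion₂.1 (hcl hy)
    exact ⟨i, (hrσ i hi).trans_le hσσ, closedBall_subset_ball (by linarith [hr i]) hyi⟩

lemma exists_radius_gt {t : ℝ} (ht : 0 < t) {d e : ℝ≥0∞} (hd : d ≠ ∞) (he : e ≠ 0) :
    ∃ R : ℝ, d.toReal < R ∧ ENNReal.ofReal (R ^ t) ≤ d ^ t + e := by
  have hc : ContinuousAt (fun R : ℝ => ENNReal.ofReal (R ^ t)) d.toReal :=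
    ENNReal.continuous_ofReal.continuousAt.comp (Real.continuousAt_rpow_const _ _ (Or.inr ht.le))
  have hv : ENNReal.ofReal (d.toReal ^ t) = d ^ t := by
    rw [← ENNReal.ofReal_rpow_of_nonneg ENNReal.toReal_nonneg ht.le, ENNReal.ofReal_toReal hd]
  have hlt : ENNReal.ofReal (d.toReal ^ t) < d ^ t + e := by
    rw [hv]
    exact ENNReal.lt_add_right (ENNReal.rpow_ne_top_of_nonneg ht.le hd) he
  have h := (hc.eventually_lt continuousAt_const hlt)
  obtain ⟨R, hR, hR2⟩ := ((h.filter_mono nhdsWithin_le_nhds).and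
    (self_mem_nhdsWithin (s := Ioi d.toReal))).exists
  exact ⟨R, hR2, hR.le⟩

/-- If every open cover of `K` carries at least mass `a` of some measure giving any closed ball of
radius `R` mass at most `C * R ^ t`, then `K` has positive `t`-dimensional Hausdorff measure. -/
lemma hausdorffMeasure_ne_zero_of_approx {n : ℕ} {t C : ℝ} {a : ℝ≥0∞} (ht : 0 < t) (hC : 0 < C)
    (ha : a ≠ 0) {K : Set (Fin n → ℝ)}
    (hK : ∀ V : Set (Fin n → ℝ), IsOpen V → K ⊆ V → ∃ μ : Measure (Fin n → ℝ), a < μ V ∧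
      ∀ y, ∀ R > 0, μ (closedBall y R) ≤ ENNReal.ofReal (C * R ^ t)) :
    μH[t] K ≠ 0 := by
  intro h0
  have hCe : ENNReal.ofReal C ≠ 0 := by simpa using hC
  set ε : ℝ≥0∞ := a / ENNReal.ofReal C / 2 with hε
  have hε0 : ε ≠ 0 := by
    rw [hε]
    exact (ENNReal.half_pos (ENNReal.div_pos ha ENNReal.ofReal_ne_top).ne').ne'
  have hlt : (⨅ (V : ℕ → Set (Fin n → ℝ)) (_ : K ⊆ ⋃ k, V k) (_ : ∀ k, ediam (V k) ≤ 1),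
      ∑' k, ⨆ _ : (V k).Nonempty, ediam (V k) ^ t) < ε := by
    refine lt_of_le_of_lt ?_ (pos_iff_ne_zero.2 hε0)
    rw [← h0, Measure.hausdorffMeasure_apply]
    exact le_iSup₂_of_le (1 : ℝ≥0∞) zero_lt_one le_rfl
  simp only [iInf_lt_iff] at hlt
  obtain ⟨S, hKS, hS1, hS⟩ := hlt
  obtain ⟨ε', hε'0, hε'⟩ := ENNReal.exists_pos_sum_of_countable' hε0 ℕ
  have hloc : ∀ k, ∃ V : Set (Fin n → ℝ), IsOpen V ∧ S k ⊆ V ∧ ∀ μ : Measure (Fin n → ℝ),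
      (∀ y, ∀ R > 0, μ (closedBall y R) ≤ ENNReal.ofReal (C * R ^ t)) →
      μ V ≤ ENNReal.ofReal C * ((⨆ _ : (S k).Nonempty, ediam (S k) ^ t) + ε' k) := by
    intro k
    rcases (S k).eq_empty_or_nonempty with he | ⟨y, hy⟩
    · exact ⟨∅, isOpen_empty, by rw [he], fun μ _ => by simp⟩
    have hd : ediam (S k) ≠ ∞ := ((hS1 k).trans_lt ENNReal.one_lt_top).ne
    obtain ⟨R, hR, hRt⟩ := exists_radius_gt ht hd (hε'0 k).ne'
    have hR0 : 0 < R := ENNReal.toReal_nonneg.trans_lt hR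
    refine ⟨ball y R, isOpen_ball, fun z hz => ?_, fun μ hμ => ?_⟩
    · rw [mem_ball, ← edist_lt_ofReal]
      exact (edist_le_ediam_of_mem hz hy).trans_lt ((ENNReal.lt_ofReal_iff_toReal_lt hd).2 hR)
    · refine (measure_mono ball_subset_closedBall).trans ((hμ y R hR0).trans ?_)
      rw [ENNReal.ofReal_mul hC.le, iSup_pos ⟨y, hy⟩]
      gcongr
  choose V hVo hSV hVμ using hloc
  obtain ⟨μ, hμa, hμ⟩ := hK (⋃ k, V k) (isOpen_iUnion hVo) (hKS.trans (iUnion_mono hSV))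
  refine hμa.not_ge ?_
  calc μ (⋃ k, V k) ≤ ∑' k, μ (V k) := measure_iUnion_le _
    _ ≤ ∑' k, ENNReal.ofReal C * ((⨆ _ : (S k).Nonempty, ediam (S k) ^ t) + ε' k) :=
        ENNReal.tsum_le_tsum fun k => hVμ k μ hμ
    _ = ENNReal.ofReal C *
        ((∑' k, ⨆ _ : (S k).Nonempty, ediam (S k) ^ t) + ∑' k, ε' k) := by
        rw [ENNReal.tsum_mul_left, ENNReal.tsum_add]
    _ ≤ ENNReal.ofReal C * (ε + ε) := by gcongr
    _ = a := by
        rw [hε, ENNReal.add_halves, ENNReal.mul_div_cancel hCe ENNReal.ofReal_ne_top]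

lemma frostmanPair_unit_cube {n : ℕ} {t : ℝ} (ht : 0 < t) (htn : t < n) :
    FrostmanPair t (2 ^ t + 1) 2⁻¹
      (volume.restrict (ball (fun _ : Fin n => (1 / 2 : ℝ)) (1 / 2)))
      (ball (fun _ : Fin n => (1 / 2 : ℝ)) (1 / 2)) := by
  have hone : volume (ball (fun _ : Fin n => (1 / 2 : ℝ)) (1 / 2)) = 1 := by
    rw [Real.volume_pi_ball _ (by norm_num)]; norm_num
  refine ⟨isOpen_ball, ?_, ?_, ?_, ⟨1, fun A => ?_⟩, 2 ^ t, by positivity, by linarith, ?_⟩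
  · rw [Measure.restrict_apply measurableSet_ball.compl, compl_inter_self, measure_empty]
  · rw [Measure.restrict_apply_univ, hone]; exact ENNReal.one_half_lt_one
  · rw [Measure.restrict_apply_univ, hone]; exact ENNReal.one_lt_top
  · rw [ENNReal.coe_one, one_mul]; exact Measure.restrict_le_self _
  · intro y R hR
    rw [← Real.mul_rpow (by norm_num) hR.le]
    rcases le_or_gt 1 (2 * R) with h | h
    · refine (measure_mono (subset_univ _)).trans ?_
      rw [Measure.restrict_apply_univ, hone, ← ENNReal.ofReal_one]
      exact ENNReal.ofReal_le_ofReal (Real.one_le_rpow h ht.le)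
    · refine (Measure.restrict_le_self _).trans ?_
      rw [Real.volume_pi_closedBall _ hR.le, Fintype.card_fin, ← Real.rpow_natCast]
      exact ENNReal.ofReal_le_ofReal
        (Real.rpow_le_rpow_of_exponent_ge (by positivity) h.le htn.le)

/-- **Mass transference principle**, in the form of a lower bound for dimensions: if the balls of
radius `r i ^ (s / n)` cover almost every point infinitely often, then the points of the unit cube
covered infinitely often by the balls of radius `r i` form a set of positive `t`-dimensional
Hausdorff measure for every `t < s`. -/
theorem hausdorffMeasure_limsup_ball_ne_zero {n : ℕ} {ι : Type*} {s t : ℝ} (hn : 0 < n)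
    (ht : 0 < t) (htn : t < n) (hts : t < s) (hsn : s ≤ n) {x : ι → Fin n → ℝ} {r : ι → ℝ}
    (hr : ∀ i, 0 < r i)
    (hfull : ∀ᵐ y : Fin n → ℝ, ∀ σ > 0, ∃ i, r i < σ ∧ y ∈ closedBall (x i) (r i ^ (s / n))) :
    μH[t] {y : Fin n → ℝ | (∀ j, y j ∈ Icc (0 : ℝ) 1) ∧
      ∀ σ > 0, ∃ i, r i < σ ∧ y ∈ ball (x i) (r i)} ≠ 0 := by
  set C : ℝ := 2 ^ t + 1 with hC
  have hC0 : 0 < C := by positivity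
  let Pr := {p : Measure (Fin n → ℝ) × Set (Fin n → ℝ) // FrostmanPair t C 2⁻¹ p.1 p.2}
  have hstep : ∀ (k : ℕ) (p : Pr), ∃ p' : Pr, IsCompact (closure p'.1.2) ∧
      closure p'.1.2 ⊆ p.1.2 ∧
      ∀ y ∈ closure p'.1.2, ∃ i, r i < 1 / ((k : ℝ) + 1) ∧ y ∈ ball (x i) (r i) := by
    intro k p
    obtain ⟨μ', U', h1, h2⟩ := p.2.exists_next hn ht htn hts hsn hr hfull
      (σ₀ := 1 / ((k : ℝ) + 1)) (by positivity)
    exact ⟨⟨(μ', U'), h1⟩, h2⟩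
  choose next hcomp hsub hball using hstep
  let p₀ : Pr := ⟨(volume.restrict (ball (fun _ : Fin n => (1 / 2 : ℝ)) (1 / 2)),
    ball (fun _ : Fin n => (1 / 2 : ℝ)) (1 / 2)), frostmanPair_unit_cube ht htn⟩
  let P : ℕ → Pr := fun k => Nat.rec p₀ next k
  let D : ℕ → Set (Fin n → ℝ) := fun k => closure (P (k + 1)).1.2
  have hDanti : Antitone D := antitone_nat_of_succ_le fun k =>
    (hsub (k + 1) (P (k + 1))).trans subset_closure
  have hD0 : D 0 ⊆ ball (fun _ : Fin n => (1 / 2 : ℝ)) (1 / 2) := hsub 0 p₀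
  have hmain : μH[t] (⋂ k, D k) ≠ 0 := by
    refine hausdorffMeasure_ne_zero_of_approx ht hC0 (a := 2⁻¹) (by simp) fun V hV hDV => ?_
    obtain ⟨k, hk⟩ := exists_subset_nhds_of_isCompact (V := D) hDanti.directed_ge
      (fun k => hcomp k (P k)) (fun y hy => hV.mem_nhds (hDV hy))
    have hP := (P (k + 1)).2
    refine ⟨(P (k + 1)).1.1, hP.lt_measure.trans_le ?_, ?_⟩
    · calc (P (k + 1)).1.1 univ ≤ (P (k + 1)).1.1 (V ∪ ((P (k + 1)).1.2)ᶜ) := by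
            refine measure_mono fun y _ => ?_
            by_cases hy : y ∈ (P (k + 1)).1.2
            · exact Or.inl (hk (subset_closure hy))
            · exact Or.inr hy
        _ ≤ _ := (measure_union_le _ _).trans (by rw [hP.measure_compl, add_zero])
    · obtain ⟨c, -, hcC, hc⟩ := hP.closedBall_le
      intro y R hR
      exact (hc y R hR).trans (ENNReal.ofReal_le_ofReal (by gcongr))
  refine fun h0 => hmain (measure_mono_null ?_ h0)
  intro y hy
  refine ⟨fun j => ?_, fun σ hσ => ?_⟩
  · have h1 := hD0 (mem_iInter.1 hy 0)
    rw [mem_ball, dist_pi_lt_iff (by norm_num)] at h1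
    have h2 := h1 j
    rw [Real.dist_eq, abs_lt] at h2
    constructor <;> linarith [h2.1, h2.2]
  · obtain ⟨k, hk⟩ := exists_nat_one_div_lt hσ
    obtain ⟨i, hi, hyi⟩ := hball k (P k) y (mem_iInter.1 hy k)
    exact ⟨i, hi.trans hk, hyi⟩

/-- A cover of `A` with small total diameter to the power `s + k` produces, in almost every
horizontal slice, a cover with small total diameter to the power `s`. -/
theorem hausdorffMeasure_slice_eq_zero {X Y : Type*} [MetricSpace X] [MeasurableSpace X]
    [BorelSpace X] [MetricSpace Y] [MeasurableSpace Y] [BorelSpace Y] (ν : Measure Y) {s k C : ℝ}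
    (hs : 0 < s) (hk : 0 ≤ k) (hν : ∀ y, ∀ R > 0, ν (closedBall y R) ≤ ENNReal.ofReal (C * R ^ k))
    [MeasurableSpace (X × Y)] [BorelSpace (X × Y)]
    {A : Set (X × Y)} (hA : μH[s + k] A = 0) :
    ∀ᵐ y ∂ν, μH[s] {x | (x, y) ∈ A} = 0 := by
  obtain ⟨ε, -, hεpos, hεlim⟩ :=
    exists_seq_strictAnti_tendsto' (show (0 : ℝ≥0∞) < 1 from zero_lt_one)
  have hcov : ∀ j : ℕ, ∃ S : ℕ → Set (X × Y), A ⊆ ⋃ i, S i ∧ (∀ i, ediam (S i) ≤ ε j) ∧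
      ∑' i, (⨆ _ : (S i).Nonempty, ediam (S i) ^ (s + k)) < ε j := by
    intro j
    have hlt : (⨅ (V : ℕ → Set (X × Y)) (_ : A ⊆ ⋃ k, V k) (_ : ∀ k, ediam (V k) ≤ ε j),
      ∑' i, ⨆ _ : (V i).Nonempty, ediam (V i) ^ (s + k)) < ε j := by
      refine lt_of_le_of_lt ?_ (hεpos j).1
      rw [← hA, Measure.hausdorffMeasure_apply]
      exact le_iSup₂_of_le (ε j) (hεpos j).1 le_rfl
    simp only [iInf_lt_iff] at hlt
    obtain ⟨S, h1, h2, h3⟩ := hlt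
    exact ⟨S, h1, h2, h3⟩
  choose S hAS hSd hSsum using hcov
  have hdom : ∀ j i, ∃ B : Set Y, MeasurableSet B ∧ (∀ p ∈ S j i, p.2 ∈ B) ∧
      ediam (S j i) ^ s * ν B ≤
        ENNReal.ofReal C * (⨆ _ : (S j i).Nonempty, ediam (S j i) ^ (s + k)) := by
    intro j i
    rcases (S j i).eq_empty_or_nonempty with he | ⟨p, hp⟩
    · exact ⟨∅, MeasurableSet.empty, by simp [he], by simp⟩
    have hd : ediam (S j i) ≠ ∞ := ((hSd j i).trans_lt ((hεpos j).2.trans ENNReal.one_lt_top)).ne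
    refine ⟨closedBall p.2 (ediam (S j i)).toReal, measurableSet_closedBall, fun p' hp' => ?_, ?_⟩
    · rw [mem_closedBall, dist_edist]
      refine ENNReal.toReal_mono hd ?_
      exact (le_max_right _ _).trans (edist_le_ediam_of_mem hp' hp)
    · rw [iSup_pos ⟨p, hp⟩]
      rcases eq_or_ne (ediam (S j i)) 0 with h0 | h0
      · rw [h0, ENNReal.zero_rpow_of_pos hs, zero_mul]; exact zero_le
      · have hpos := ENNReal.toReal_pos h0 hd
        calc _ ≤ ediam (S j i) ^ s * ENNReal.ofReal (C * (ediam (S j i)).toReal ^ k) := by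
              gcongr; exact hν _ _ hpos
          _ = _ := by
              rw [mul_comm C, ENNReal.ofReal_mul (by positivity),
                ← ENNReal.ofReal_rpow_of_nonneg hpos.le hk, ENNReal.ofReal_toReal hd,
                ENNReal.rpow_add _ _ h0 hd]
              ring
  choose B hBm hSB hBν using hdom
  let f : ℕ → Y → ℝ≥0∞ := fun j y => ∑' i, (B j i).indicator (fun _ => ediam (S j i) ^ s) y
  have hfm : ∀ j, Measurable (f j) := fun j =>
    Measurable.tsum fun i => measurable_const.indicator (hBm j i)
  have hfint : ∀ j, ∫⁻ y, f j y ∂ν ≤ ENNReal.ofReal C * ε j := by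
    intro j
    rw [lintegral_tsum fun i => (measurable_const.indicator (hBm j i)).aemeasurable]
    calc _ = ∑' i, ediam (S j i) ^ s * ν (B j i) := by
          congr with i
          rw [lintegral_indicator (hBm j i), setLIntegral_const]
      _ ≤ ∑' i, ENNReal.ofReal C * (⨆ _ : (S j i).Nonempty, ediam (S j i) ^ (s + k)) :=
          ENNReal.tsum_le_tsum (hBν j)
      _ ≤ _ := by rw [ENNReal.tsum_mul_left]; gcongr; exact (hSsum j).le
  have hlim : ∫⁻ y, liminf (fun j => f j y) atTop ∂ν = 0 := by
    refine le_antisymm ((lintegral_liminf_le hfm).trans ?_) zero_le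
    have h1 : Tendsto (fun j => ENNReal.ofReal C * ε j) atTop (𝓝 0) := by
      simpa using ENNReal.Tendsto.const_mul hεlim (Or.inr ENNReal.ofReal_ne_top)
    rw [← h1.liminf_eq]
    exact liminf_le_liminf (Eventually.of_forall hfint)
  rw [lintegral_eq_zero_iff (Measurable.liminf hfm)] at hlim
  filter_upwards [hlim] with y hy
  have hy' : liminf (fun j => f j y) atTop = 0 := hy
  refine le_antisymm ?_ zero_le
  rw [← hy']
  refine (Measure.hausdorffMeasure_le_liminf_tsum s _ ε hεlim
    (fun j i => {x | (x, y) ∈ S j i ∧ y ∈ B j i}) (Eventually.of_forall fun j i => ?_)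
    (Eventually.of_forall fun j x hx => ?_)).trans
    (liminf_le_liminf (Eventually.of_forall fun j => ENNReal.tsum_le_tsum fun i => ?_))
  · refine (ediam_le fun x hx x' hx' => ?_).trans (hSd j i)
    exact (le_max_left _ _).trans (edist_le_ediam_of_mem hx.1 hx'.1)
  · obtain ⟨i, hi⟩ := mem_iUnion.1 (hAS j hx)
    exact mem_iUnion.2 ⟨i, hi, hSB j i _ hi⟩
  · by_cases hyB : y ∈ B j i
    · rw [indicator_of_mem hyB]
      refine ENNReal.rpow_le_rpow (ediam_le fun x hx x' hx' => ?_) hs.le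
      exact (le_max_left _ _).trans (edist_le_ediam_of_mem hx.1 hx'.1)
    · rw [indicator_of_notMem hyB]
      simp [hyB, ENNReal.zero_rpow_of_pos hs]

/-- A measurable set of positive measure that is invariant under a dense set of
translations has full measure. -/
theorem ae_mem_of_dense_translations {E : Type*} [NormedAddCommGroup E] [NormedSpace ℝ E]
    [FiniteDimensional ℝ E] [MeasurableSpace E] [BorelSpace E] (μ : Measure E)
    [μ.IsAddHaarMeasure] {A : Set E} (hA : MeasurableSet A) (hpos : μ A ≠ 0) {D : Set E}
    (hD : Dense D) (hinv : ∀ d ∈ D, ∀ x ∈ A, d + x ∈ A) : ∀ᵐ x ∂μ, x ∈ A := by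
  obtain ⟨B, hBA, hB, hB0, hBtop⟩ : ∃ B ⊆ A, MeasurableSet B ∧ μ B ≠ 0 ∧ μ B ≠ ∞ := by
    obtain ⟨B, hBA, hB, hB0, hBtop⟩ := Measure.exists_subset_measure_lt_top (μ := μ) hA
      (pos_iff_ne_zero.2 hpos)
    exact ⟨B, hB, hBA, hB0.ne', hBtop.ne⟩
  let F : C(E, C(E, E)) := ContinuousMap.curry ⟨fun p : E × E => -p.1 + p.2, by fun_prop⟩
  have hF : ∀ t x, F t x = -t + x := fun t x => rfl
  have hFm : ∀ t, MeasurePreserving (F t) μ μ := fun t => measurePreserving_add_left μ (-t)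
  have hzero : ∀ t, μ (F t ⁻¹' B ∩ Aᶜ) = 0 := by
    intro t
    have hlim := tendsto_measure_symmDiff_preimage_nhds_zero (F.continuous.tendsto t)
      (Eventually.of_forall hFm) (hFm t) hB.nullMeasurableSet hBtop
    have hlim' := hlim.mono_left (nhdsWithin_le_nhds (s := D))
    have : (𝓝[D] t).NeBot := mem_closure_iff_nhdsWithin_neBot.1 (hD t)
    refine le_antisymm (ge_of_tendsto hlim' ?_) zero_le
    filter_upwards [self_mem_nhdsWithin] with d hd
    refine measure_mono fun x hx => Or.inr ⟨hx.1, fun hxd => hx.2 ?_⟩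
    have := hinv d hd _ (hBA hxd)
    simpa [hF] using this
  have hswap : ∫⁻ x in Aᶜ, ∫⁻ t, B.indicator 1 (-t + x) ∂μ ∂μ = 0 := by
    rw [lintegral_lintegral_swap]
    · refine (lintegral_congr fun t => ?_).trans lintegral_zero
      have h := hzero t
      rw [← Measure.restrict_apply ((hFm t).measurable hB)] at h
      rw [← h, ← lintegral_indicator_one ((hFm t).measurable hB)]
      rfl
    · exact ((measurable_one.indicator hB).comp (by fun_prop)).aemeasurable
  have hin : ∀ x, ∫⁻ t, B.indicator (1 : E → ℝ≥0∞) (-t + x) ∂μ = μ B := by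
    intro x
    rw [← lintegral_indicator_one hB, ← lintegral_sub_left_eq_self (B.indicator 1) x]
    simp [neg_add_eq_sub]
  simp only [hin, lintegral_const, Measure.restrict_apply MeasurableSet.univ, univ_inter] at hswap
  exact (mul_eq_zero.1 hswap).resolve_left hB0

theorem nint_le (ξ : ℝ) (p : ℤ) : nint ξ ≤ |ξ - p| :=
  ciInf_le ⟨0, by rintro _ ⟨p, rfl⟩; exact abs_nonneg _⟩ p

theorem nint_lt_iff {ξ ε : ℝ} : nint ξ < ε ↔ ∃ p : ℤ, |ξ - p| < ε := by
  constructor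
  · exact fun h => exists_lt_of_ciInf_lt h
  · rintro ⟨p, hp⟩
    exact (nint_le ξ p).trans_lt hp

theorem supNint_lt_iff {n : ℕ} (hn : 1 ≤ n) {u : Fin n → ℝ} {ε : ℝ} :
    supNint u < ε ↔ ∃ p : Fin n → ℤ, ∀ j, |u j - p j| < ε := by
  have : Nonempty (Fin n) := ⟨⟨0, hn⟩⟩
  have h : supNint u < ε ↔ ∀ j, nint (u j) < ε := by
    constructor
    · exact fun h j => (le_ciSup (f := fun j => nint (u j)) (Finite.bddAbove_range _) j).trans_lt h
    · intro h
      obtain ⟨j, hj⟩ := exists_eq_ciSup_of_finite (f := fun j => nint (u j))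
      exact (show supNint u = nint (u j) from hj.symm) ▸ h j
  simp only [h, nint_lt_iff, Classical.skolem]

theorem natAbs_le_supNorm {m : ℕ} (q : Fin m → ℤ) (i : Fin m) : (q i).natAbs ≤ supNorm q :=
  Finset.le_sup (f := fun i => (q i).natAbs) (Finset.mem_univ i)

theorem abs_le_supNorm {m : ℕ} (q : Fin m → ℤ) (i : Fin m) : |(q i : ℝ)| ≤ supNorm q := by
  have h : (((q i).natAbs : ℕ) : ℝ) ≤ supNorm q := by exact_mod_cast natAbs_le_supNorm q i
  simpa using h

theorem exists_supNorm_eq {m : ℕ} (hm : 1 ≤ m) (q : Fin m → ℤ) :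
    ∃ i, supNorm q = (q i).natAbs := by
  obtain ⟨i, -, hi⟩ := Finset.exists_mem_eq_sup (Finset.univ : Finset (Fin m)) ⟨⟨0, hm⟩, by simp⟩
    fun i => (q i).natAbs
  exact ⟨i, hi⟩

theorem supNorm_pos {m : ℕ} {q : Fin m → ℤ} (hq : q ≠ 0) : 0 < supNorm q := by
  obtain ⟨i, hi⟩ := Function.ne_iff.1 hq
  exact (Int.natAbs_pos.2 hi).trans_le (natAbs_le_supNorm q i)

theorem finite_supNorm_le (m K : ℕ) : {q : Fin m → ℤ | supNorm q ≤ K}.Finite := by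
  refine (Set.finite_Icc (fun _ => -(K : ℤ)) (fun _ => (K : ℤ))).subset fun q hq => ?_
  have h := fun i => (natAbs_le_supNorm q i).trans hq
  exact ⟨fun i => by have := h i; simp only; omega, fun i => by have := h i; simp only; omega⟩

/-- A set of integer vectors is infinite iff it contains vectors of arbitrarily large norm. -/
theorem infinite_iff_supNorm {m : ℕ} {S : Set (Fin m → ℤ)} :
    S.Infinite ↔ ∀ K : ℕ, ∃ q ∈ S, K ≤ supNorm q := by
  constructor
  · intro h K
    by_contra! h'
    exact h ((finite_supNorm_le m K).subset fun q hq => (h' q hq).le)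
  · intro h hfin
    obtain ⟨K, hK⟩ := (hfin.image supNorm).bddAbove
    obtain ⟨q, hq, hqK⟩ := h (K + 1)
    have := hK (mem_image_of_mem _ hq)
    omega

/-- Dirichlet's theorem for systems of linear forms. -/
theorem exists_linearForms_lt {m n : ℕ} (hm : 1 ≤ m) (X : Fin m → Fin n → ℝ) {M : ℕ}
    (hM : 1 ≤ M) : ∃ q : Fin m → ℤ, q ≠ 0 ∧ supNorm q ≤ M ^ n ∧
      ∃ p : Fin n → ℤ, ∀ j, |∑ i, (q i : ℝ) * X i j - p j| < 1 / (M : ℝ) ^ m := by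
  have hMm : (0 : ℝ) < (M : ℝ) ^ m := by positivity
  let f : (Fin m → Fin (M ^ n + 1)) → Fin n → ℝ := fun q j => ∑ i, ((q i : ℕ) : ℝ) * X i j
  have hlt : ∀ q j, ⌊Int.fract (f q j) * (M : ℝ) ^ m⌋₊ < M ^ m := fun q j => by
    rw [Nat.floor_lt (by have := Int.fract_nonneg (f q j); positivity)]
    push_cast
    exact mul_lt_of_lt_one_left hMm (Int.fract_lt_one _)
  let g : (Fin m → Fin (M ^ n + 1)) → Fin n → Fin (M ^ m) := fun q j => ⟨_, hlt q j⟩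
  obtain ⟨a, b, hab, hg⟩ : ∃ a b, a ≠ b ∧ g a = g b := by
    refine Fintype.exists_ne_map_eq_of_card_lt g ?_
    simp only [Fintype.card_pi, Fintype.card_fin, Finset.prod_const, Finset.card_univ]
    rw [← pow_mul, mul_comm m n, pow_mul]
    exact Nat.pow_lt_pow_left (Nat.lt_succ_self _) (by omega)
  refine ⟨fun i => (a i : ℤ) - (b i : ℤ), fun h => hab ?_, ?_,
    fun j => ⌊f a j⌋ - ⌊f b j⌋, fun j => ?_⟩
  · ext i
    have := congrFun h i
    simp only [Pi.zero_apply] at this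
    omega
  · refine Finset.sup_le fun i _ => ?_
    have := (a i).2
    have := (b i).2
    simp only
    omega
  · have h1 : ∑ i, (((a i : ℤ) - (b i : ℤ) : ℤ) : ℝ) * X i j - ((⌊f a j⌋ - ⌊f b j⌋ : ℤ) : ℝ) =
        Int.fract (f a j) - Int.fract (f b j) := by
      simp only [f, Int.fract]
      push_cast
      simp only [sub_mul, Finset.sum_sub_distrib]
      ring
    rw [h1, lt_div_iff₀ hMm, ← abs_of_pos hMm, ← abs_mul, sub_mul]
    refine Int.abs_sub_lt_one_of_floor_eq_floor ?_
    have h2 := Fin.val_eq_of_eq (congrFun hg j)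
    simp only [g] at h2
    have ha := Int.fract_nonneg (f a j)
    have hb := Int.fract_nonneg (f b j)
    rw [← Int.natCast_floor_eq_floor (by positivity), ← Int.natCast_floor_eq_floor (by positivity), h2]

/-- Dirichlet's theorem gives solutions of arbitrarily large norm. -/
theorem exists_linearForms_lt_rpow {m n : ℕ} (hm : 1 ≤ m) (hn : 1 ≤ n) (X : Fin m → Fin n → ℝ)
    (K : ℕ) : ∃ q : Fin m → ℤ, q ≠ 0 ∧ K ≤ supNorm q ∧ ∃ p : Fin n → ℤ, ∀ j,
      |∑ i, (q i : ℝ) * X i j - p j| < (supNorm q : ℝ) ^ (-((m : ℝ) / n)) := by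
  have hbound : ∀ {M : ℕ}, 1 ≤ M → ∀ q : Fin m → ℤ, q ≠ 0 → supNorm q ≤ M ^ n →
      1 / (M : ℝ) ^ m ≤ (supNorm q : ℝ) ^ (-((m : ℝ) / n)) := by
    intro M hM q hq hqM
    have h0 : (0 : ℝ) < supNorm q := by exact_mod_cast supNorm_pos hq
    have hM0 : (0 : ℝ) < M := by exact_mod_cast hM
    have h1 : (supNorm q : ℝ) ≤ (M : ℝ) ^ (n : ℝ) := by rw [Real.rpow_natCast]; exact_mod_cast hqM
    calc 1 / (M : ℝ) ^ m = ((M : ℝ) ^ (n : ℝ)) ^ (-((m : ℝ) / n)) := by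
          rw [← Real.rpow_mul hM0.le, one_div, ← Real.rpow_natCast, ← Real.rpow_neg hM0.le]
          congr 1
          have : (n : ℝ) ≠ 0 := by positivity
          field_simp
      _ ≤ _ := Real.rpow_le_rpow_of_nonpos h0 h1 (by rw [neg_nonpos]; positivity)
  by_cases hex : ∃ q : Fin m → ℤ, q ≠ 0 ∧ ∃ p : Fin n → ℤ, ∀ j, ∑ i, (q i : ℝ) * X i j = p j
  · obtain ⟨q, hq, p, hp⟩ := hex
    have hq' : ((K : ℤ) + 1) • q ≠ 0 := smul_ne_zero (by positivity) hq
    refine ⟨((K : ℤ) + 1) • q, hq', ?_, ((K : ℤ) + 1) • p, fun j => ?_⟩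
    · obtain ⟨i, hi⟩ := Function.ne_iff.1 hq
      have h1 := natAbs_le_supNorm (((K : ℤ) + 1) • q) i
      have h2 : 1 ≤ (q i).natAbs := Int.natAbs_pos.2 hi
      have h3 : (((K : ℤ) + 1) • q) i = ((K : ℤ) + 1) * q i := rfl
      rw [h3, Int.natAbs_mul, show ((K : ℤ) + 1).natAbs = K + 1 by omega] at h1
      nlinarith
    · have : ∑ i, ((((K : ℤ) + 1) • q) i : ℝ) * X i j - ((((K : ℤ) + 1) • p) j : ℝ) = 0 := by
        simp only [Pi.smul_apply, smul_eq_mul, Int.cast_mul, ← hp, Finset.mul_sum]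
        rw [sub_eq_zero]
        exact Finset.sum_congr rfl fun i _ => by ring
      rw [this, abs_zero]
      have h0 : (0 : ℝ) < supNorm (((K : ℤ) + 1) • q) := by exact_mod_cast supNorm_pos hq'
      positivity
  · push Not at hex
    have hfin : {q : Fin m → ℤ | q ≠ 0 ∧ supNorm q ≤ K}.Finite :=
      (finite_supNorm_le m K).subset fun q hq => hq.2
    have hpos : ∀ q : Fin m → ℤ, q ≠ 0 → 0 < supNint (fun j => ∑ i, (q i : ℝ) * X i j) := by
      intro q hq
      by_contra! h
      obtain ⟨j, hj⟩ := hex q hq fun j => round (∑ i, (q i : ℝ) * X i j)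
      have hj' : nint (∑ i, (q i : ℝ) * X i j) ≤ 0 :=
        (le_ciSup (f := fun j => nint (∑ i, (q i : ℝ) * X i j)) (Finite.bddAbove_range _) j).trans h
      refine hj (sub_eq_zero.1 (abs_eq_zero.1 (le_antisymm (le_trans ?_ hj') (abs_nonneg _))))
      exact le_ciInf fun p => round_le _ p
    obtain ⟨ε, hε, hεq⟩ : ∃ ε > 0, ∀ q : Fin m → ℤ, q ≠ 0 → supNorm q ≤ K →
        ε ≤ supNint (fun j => ∑ i, (q i : ℝ) * X i j) := by
      rcases {q : Fin m → ℤ | q ≠ 0 ∧ supNorm q ≤ K}.eq_empty_or_nonempty with he | hne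
      · exact ⟨1, one_pos, fun q h1 h2 => (he.subset (show q ∈ _ from ⟨h1, h2⟩)).elim⟩
      · obtain ⟨q₀, hq₀, hmin⟩ := hfin.exists_minimalFor
          (fun q => supNint (fun j => ∑ i, (q i : ℝ) * X i j)) _ hne
        exact ⟨_, hpos q₀ hq₀.1, fun q h1 h2 => (le_total _ _).elim id (hmin ⟨h1, h2⟩)⟩
    obtain ⟨M, hM⟩ := exists_nat_one_div_lt hε
    obtain ⟨q, hq, hqM, p, hp⟩ := exists_linearForms_lt hm X (Nat.le_add_left 1 M)
    refine ⟨q, hq, ?_, p, fun j => (hp j).trans_le (hbound (Nat.le_add_left 1 M) q hq hqM)⟩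
    by_contra! hK
    have h1 := (supNint_lt_iff hn).2 ⟨p, hp⟩
    refine absurd (h1.trans_le ?_) (hεq q hq hK.le).not_gt
    refine le_trans ?_ hM.le
    push_cast
    exact one_div_le_one_div_of_le (by positivity)
      (le_self_pow₀ (by linarith [(Nat.cast_nonneg M : (0 : ℝ) ≤ M)]) (by omega))

theorem Wv_eq_of_le {m n : ℕ} (hm : 1 ≤ m) (hn : 1 ≤ n) {v : ℝ} (hv : v ≤ (m : ℝ) / n) :
    Wv m n v = {X | ∀ i j, X i j ∈ Icc (0 : ℝ) 1} := by
  ext X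
  refine ⟨fun h => h.1, fun h => ⟨h, infinite_iff_supNorm.2 fun K => ?_⟩⟩
  obtain ⟨q, hq, hK, p, hp⟩ := exists_linearForms_lt_rpow hm hn X K
  refine ⟨q, ⟨hq, (supNint_lt_iff hn).2 ⟨p, fun j => (hp j).trans_le ?_⟩⟩, hK⟩
  exact Real.rpow_le_rpow_of_exponent_le (by exact_mod_cast supNorm_pos hq) (by linarith)

theorem dimH_Wv_of_le {m n : ℕ} (hm : 1 ≤ m) (hn : 1 ≤ n) {v : ℝ} (hv : v ≤ (m : ℝ) / n) :
    dimH (Wv m n v) = ((m * n : ℕ) : ENNReal) := by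
  rw [Wv_eq_of_le hm hn hv, Real.dimH_of_nonempty_interior]
  · simp [Module.finrank_pi_fintype]
  · refine ⟨fun _ _ => 1 / 2, mem_interior.2 ⟨ball (fun _ _ => 1 / 2) (1 / 2), fun X hX i j => ?_,
      isOpen_ball, mem_ball_self (by norm_num)⟩⟩
    have h1 := (dist_le_pi_dist (X i) _ j).trans_lt
      ((dist_le_pi_dist X (fun _ _ => 1 / 2) i).trans_lt hX)
    rw [Real.dist_eq, abs_lt] at h1
    constructor <;> linarith [h1.1, h1.2]

/-- The matrices `X` for which the exponent `α` is attained, up to a constant, by infinitely many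
`q` whose norm is attained at the coordinate `i`. -/
def approxAt {m n : ℕ} (α : ℝ) (i : Fin m) : Set (Fin m → Fin n → ℝ) :=
  {X | ∃ C : ℕ, ∀ K : ℕ, ∃ q : Fin m → ℤ, (K ≤ supNorm q ∧ supNorm q = (q i).natAbs) ∧
    ∃ p : Fin n → ℤ, ∀ j, |∑ k, (q k : ℝ) * X k j - p j| ≤ C * (supNorm q : ℝ) ^ (-α)}

theorem measurableSet_approxAt {m n : ℕ} (α : ℝ) (i : Fin m) :
    MeasurableSet (approxAt α i : Set (Fin m → Fin n → ℝ)) := by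
  simp only [approxAt, ofPred_exists, ofPred_forall, ofPred_and]
  refine MeasurableSet.iUnion fun C => MeasurableSet.iInter fun K => MeasurableSet.iUnion fun q =>
    ((MeasurableSet.const _).inter (MeasurableSet.const _)).inter (
      MeasurableSet.iUnion fun p => MeasurableSet.iInter fun j => ?_)
  exact (isClosed_le (by fun_prop) continuous_const).measurableSet

theorem supNorm_natCast_smul {m : ℕ} (hm : 1 ≤ m) (d : ℕ) (q : Fin m → ℤ) :
    supNorm ((d : ℤ) • q) = d * supNorm q := by
  have h : ∀ k, (((d : ℤ) • q) k).natAbs = d * (q k).natAbs := fun k => by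
    simp [Int.natAbs_mul]
  refine le_antisymm (Finset.sup_le fun k _ => ?_) ?_
  · rw [h]
    exact Nat.mul_le_mul_left _ (natAbs_le_supNorm q k)
  · obtain ⟨i, hi⟩ := exists_supNorm_eq hm q
    rw [hi, ← h]
    exact natAbs_le_supNorm _ i

theorem add_mem_approxAt {m n : ℕ} {α : ℝ} {i : Fin m} {X T : Fin m → Fin n → ℝ}
    (hX : X ∈ approxAt α i) {d : ℕ} (hd : 0 < d) {N : Fin m → Fin n → ℤ}
    (hT : ∀ k j, T k j = N k j / d) : T + X ∈ approxAt α i := by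
  obtain ⟨C, hC⟩ := hX
  have hd0 : (0 : ℝ) < d := by exact_mod_cast hd
  refine ⟨⌈(d : ℝ) * C * (d : ℝ) ^ α⌉₊, fun K => ?_⟩
  obtain ⟨q, ⟨hqK, hqi⟩, p, hp⟩ := hC K
  have hn := supNorm_natCast_smul (Fin.pos i) d q
  refine ⟨(d : ℤ) • q, ⟨?_, ?_⟩, fun j => d * p j + ∑ k, q k * N k j, fun j => ?_⟩
  · rw [hn]
    exact hqK.trans (Nat.le_mul_of_pos_left _ hd)
  · rw [hn, hqi]
    simp [Int.natAbs_mul]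
  · have h1 : ∑ k, ((((d : ℤ) • q) k : ℤ) : ℝ) * (T + X) k j -
        ((d * p j + ∑ k, q k * N k j : ℤ) : ℝ) = d * (∑ k, (q k : ℝ) * X k j - p j) := by
      simp only [Pi.smul_apply, Pi.add_apply, hT, smul_eq_mul, mul_sub, Finset.mul_sum]
      push_cast
      rw [add_comm (_ * _), sub_add_eq_sub_sub, ← Finset.sum_sub_distrib]
      congr 1
      refine Finset.sum_congr rfl fun k _ => ?_
      field_simp
      ring
    rw [h1, abs_mul, abs_of_pos hd0, hn, Nat.cast_mul, Real.mul_rpow hd0.le (Nat.cast_nonneg _)]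
    calc (d : ℝ) * |∑ k, (q k : ℝ) * X k j - p j| ≤ d * (C * (supNorm q : ℝ) ^ (-α)) := by
          gcongr
          exact hp j
      _ = (d * C * (d : ℝ) ^ α) * ((d : ℝ) ^ (-α) * (supNorm q : ℝ) ^ (-α)) := by
          rw [Real.rpow_neg hd0.le]
          have := Real.rpow_pos_of_pos hd0 α
          field_simp
      _ ≤ _ := by
          gcongr
          exact Nat.le_ceil _

theorem exists_ae_mem_approxAt {m n : ℕ} (hm : 1 ≤ m) (hn : 1 ≤ n) :
    ∃ i : Fin m, ∀ᵐ X : Fin m → Fin n → ℝ, X ∈ approxAt ((m : ℝ) / n) i := by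
  have hcover : ∀ X : Fin m → Fin n → ℝ, ∃ i, X ∈ approxAt ((m : ℝ) / n) i := by
    intro X
    choose q hq hK p hp using exists_linearForms_lt_rpow hm hn X
    choose i hi using fun K => exists_supNorm_eq hm (q K)
    obtain ⟨i₀, hi₀⟩ := Finite.exists_infinite_fiber i
    rw [Set.infinite_coe_iff, Set.infinite_iff_exists_gt (s := i ⁻¹' {i₀})] at hi₀
    refine ⟨i₀, 1, fun K => ?_⟩
    obtain ⟨K', rfl, hK'⟩ := hi₀ K
    refine ⟨q K', ⟨hK'.le.trans (hK K'), hi K'⟩, p K', fun j => ?_⟩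
    rw [Nat.cast_one, one_mul]
    exact (hp K' j).le
  have hpos : ∃ i : Fin m,
      volume (approxAt ((m : ℝ) / n) i : Set (Fin m → Fin n → ℝ)) ≠ 0 := by
    by_contra! h
    have h1 : (⋃ i, approxAt ((m : ℝ) / n) i : Set (Fin m → Fin n → ℝ)) = univ :=
      eq_univ_of_forall fun X => mem_iUnion.2 (hcover X)
    have h2 := measure_iUnion_null h
    rw [h1, Measure.measure_univ_eq_zero] at h2
    exact NeZero.ne _ h2
  obtain ⟨i, hi⟩ := hpos
  refine ⟨i, ae_mem_of_dense_translations volume (measurableSet_approxAt _ i) hi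
    (D := {T | ∃ d : ℕ, 0 < d ∧ ∃ N : Fin m → Fin n → ℤ, ∀ k j, T k j = N k j / d}) ?_ ?_⟩
  · refine Metric.dense_iff.2 fun X ε hε => ?_
    obtain ⟨d, hd⟩ := exists_nat_one_div_lt hε
    have hd0 : (0 : ℝ) < ((d + 1 : ℕ) : ℝ) := by positivity
    refine ⟨fun k j => (⌊X k j * (d + 1 : ℕ)⌋ : ℝ) / (d + 1 : ℕ), ?_, d + 1, by omega, _,
      fun k j => rfl⟩
    rw [mem_ball, dist_comm]
    refine (dist_pi_lt_iff hε).2 fun k => (dist_pi_lt_iff hε).2 fun j => ?_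
    rw [Real.dist_eq]
    refine lt_of_le_of_lt ?_ hd
    have h1 : X k j - (⌊X k j * (d + 1 : ℕ)⌋ : ℝ) / (d + 1 : ℕ) =
        Int.fract (X k j * (d + 1 : ℕ)) / (d + 1 : ℕ) := by
      rw [Int.fract]
      field_simp
    rw [h1, abs_of_nonneg (div_nonneg (Int.fract_nonneg _) hd0.le), ← Nat.cast_succ]
    exact div_le_div_of_nonneg_right (Int.fract_lt_one _).le hd0.le
  · rintro T ⟨d, hd, N, hT⟩ X hX
    exact add_mem_approxAt hX hd hT

/-- The solution for row `i` of the system `q X = p`, given the other rows `Y`. -/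
noncomputable def rowCenter {m n : ℕ} (i : Fin (m + 1)) (Y : Fin m → Fin n → ℝ)
    (q : Fin (m + 1) → ℤ) (p : Fin n → ℤ) (j : Fin n) : ℝ :=
  (p j - ∑ k, (q (i.succAbove k) : ℝ) * Y k j) / q i

theorem abs_sum_insertNth_sub {m n : ℕ} (i : Fin (m + 1)) (Y : Fin m → Fin n → ℝ)
    {q : Fin (m + 1) → ℤ} (hq : supNorm q = (q i).natAbs) (hqi : q i ≠ 0) (p : Fin n → ℤ)
    (x : Fin n → ℝ) (j : Fin n) :
    |∑ k, (q k : ℝ) * (i.insertNth x Y : Fin (m + 1) → Fin n → ℝ) k j - p j| =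
      supNorm q * |x j - rowCenter i Y q p j| := by
  have hqi' : (q i : ℝ) ≠ 0 := by exact_mod_cast hqi
  have hq' : (supNorm q : ℝ) = |(q i : ℝ)| := by rw [hq, Nat.cast_natAbs, Int.cast_abs]
  rw [hq', ← abs_mul, Fin.sum_univ_succAbove _ i]
  simp only [Fin.insertNth_apply_same, Fin.insertNth_apply_succAbove, rowCenter]
  congr 1
  field_simp
  ring

theorem hausdorffMeasure_fiber_ne_zero {m n : ℕ} (hn : 1 ≤ n) {v t : ℝ}
    (hv : ((m + 1 : ℕ) : ℝ) / n < v) (ht : 0 < t)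
    (htv : t < (((m + 1 : ℕ) : ℝ) + n) / (v + 1)) (i : Fin (m + 1)) {Y : Fin m → Fin n → ℝ}
    (hY : ∀ k j, Y k j ∈ Icc (0 : ℝ) 1) (hae : ∀ᵐ x : Fin n → ℝ,
      (i.insertNth x Y : Fin (m + 1) → Fin n → ℝ) ∈ approxAt (((m + 1 : ℕ) : ℝ) / n) i) :
    μH[t] {x : Fin n → ℝ | (i.insertNth x Y : Fin (m + 1) → Fin n → ℝ) ∈ Wv (m + 1) n v} ≠ 0 := by
  have hn0 : (0 : ℝ) < n := by exact_mod_cast hn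
  set α : ℝ := ((m + 1 : ℕ) : ℝ) / n with hα
  have hα0 : 0 < α := by positivity
  have hv1 : 0 < v + 1 := by linarith
  have hmn : ((m + 1 : ℕ) : ℝ) + n = (α + 1) * n := by rw [hα]; field_simp
  rw [hmn] at htv
  obtain ⟨s, hts, hsv⟩ := exists_between htv
  have hs0 : 0 < s := ht.trans hts
  have hsn : s < n := hsv.trans ((div_lt_iff₀ hv1).2 (by nlinarith))
  have hexp : (v + 1) * (s / n) < α + 1 := by
    rw [lt_div_iff₀ hv1] at hsv
    rw [← mul_div_assoc, div_lt_iff₀ hn0]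
    linarith
  let I := {a : (Fin (m + 1) → ℤ) × (Fin n → ℤ) // supNorm a.1 = (a.1 i).natAbs ∧ a.1 i ≠ 0}
  have hpos : ∀ a : I, (0 : ℝ) < supNorm a.1.1 := fun a => by
    rw [a.2.1]
    exact_mod_cast Int.natAbs_pos.2 a.2.2
  have hlim : ∀ {β : ℝ}, 0 < β → Tendsto (fun k : ℕ => (k : ℝ) ^ (-β)) atTop (𝓝 0) := fun hβ =>
    (tendsto_rpow_neg_atTop hβ).comp tendsto_natCast_atTop_atTop
  have key := hausdorffMeasure_limsup_ball_ne_zero (n := n) (ι := I) hn ht (hts.trans hsn) hts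
    hsn.le (x := fun a => rowCenter i Y a.1.1 a.1.2)
    (r := fun a => (supNorm a.1.1 : ℝ) ^ (-(v + 1))) (fun a => Real.rpow_pos_of_pos (hpos a) _) ?_
  · refine fun h0 => key (measure_mono_null ?_ h0)
    rintro x ⟨hx, hx'⟩
    refine ⟨fun k j => ?_, infinite_iff_supNorm.2 fun K => ?_⟩
    · induction k using Fin.succAboveCases i with
      | x => simpa using hx j
      | p k => simpa using hY k j
    · obtain ⟨⟨⟨q, p⟩, hq, hqi⟩, hr, hxa⟩ := hx' ((K + 1 : ℝ) ^ (-(v + 1)))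
        (by positivity)
      have hq0 := hpos ⟨⟨q, p⟩, hq, hqi⟩
      simp only at hr hxa hq hqi hq0
      refine ⟨q, ⟨fun h => hqi (by simp [h]), (supNint_lt_iff hn).2 ⟨p, fun j => ?_⟩⟩, ?_⟩
      · rw [abs_sum_insertNth_sub i Y hq hqi]
        have h1 := (dist_le_pi_dist x _ j).trans_lt hxa
        rw [Real.dist_eq] at h1
        calc _ < (supNorm q : ℝ) * (supNorm q : ℝ) ^ (-(v + 1)) := by gcongr
          _ = _ := by
            rw [← Real.rpow_one_add' hq0.le (by linarith)]
            congr 1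
            ring
      · by_contra! h
        refine hr.not_ge (Real.rpow_le_rpow_of_nonpos hq0 ?_ (by linarith))
        have : (supNorm q : ℝ) < K := by exact_mod_cast h
        linarith
  · filter_upwards [hae] with x hx σ hσ
    obtain ⟨C, hC⟩ := hx
    have hev : ∀ᶠ k : ℕ in atTop, 1 ≤ k ∧ (k : ℝ) ^ (-(v + 1)) < σ ∧
        (C : ℝ) ≤ (k : ℝ) ^ (α + 1 - (v + 1) * (s / n)) :=
      (eventually_ge_atTop 1).and (((hlim hv1).eventually (gt_mem_nhds hσ)).and
        (((tendsto_rpow_atTop (sub_pos.2 hexp)).comp tendsto_natCast_atTop_atTop).eventually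
          (eventually_ge_atTop _)))
    obtain ⟨K, hK⟩ := eventually_atTop.1 hev
    obtain ⟨q, ⟨hqK, hq⟩, p, hp⟩ := hC K
    obtain ⟨h1, h2, h3⟩ := hK _ hqK
    have hqi : q i ≠ 0 := Int.natAbs_pos.1 (hq ▸ h1)
    have hq0 := hpos ⟨⟨q, p⟩, hq, hqi⟩
    simp only at hq0
    refine ⟨⟨⟨q, p⟩, hq, hqi⟩, h2, ?_⟩
    refine (dist_pi_le_iff (by positivity)).2 fun j => ?_
    have h4 := hp j
    rw [abs_sum_insertNth_sub i Y hq hqi] at h4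
    rw [Real.dist_eq, ← mul_le_mul_iff_right₀ hq0]
    refine h4.trans ?_
    simp only
    calc (C : ℝ) * (supNorm q : ℝ) ^ (-α) ≤
        (supNorm q : ℝ) ^ (α + 1 - (v + 1) * (s / n)) * (supNorm q : ℝ) ^ (-α) := by gcongr
      _ = (supNorm q : ℝ) ^ (1 + -(v + 1) * (s / n)) := by
          rw [← Real.rpow_add hq0]
          congr 1
          ring
      _ = _ := by rw [← Real.rpow_mul hq0.le, Real.rpow_add hq0, Real.rpow_one]

theorem le_dimH_Wv {m n : ℕ} (hn : 1 ≤ n) {v : ℝ} (hv : ((m + 1 : ℕ) : ℝ) / n < v) :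
    ENNReal.ofReal ((((m + 1 : ℕ) : ℝ) + n) / (v + 1) + m * n) ≤ dimH (Wv (m + 1) n v) := by
  have hn0 : (0 : ℝ) < n := by exact_mod_cast hn
  have hα0 : 0 < ((m + 1 : ℕ) : ℝ) / n := by positivity
  have hd : 0 < (((m + 1 : ℕ) : ℝ) + n) / (v + 1) := div_pos (by positivity) (by linarith)
  have key : ∀ t : ℝ, 0 < t → t < (((m + 1 : ℕ) : ℝ) + n) / (v + 1) →
      ENNReal.ofReal (t + m * n) ≤ dimH (Wv (m + 1) n v) := by
    intro t ht htv
    refine le_dimH_of_hausdorffMeasure_ne_zero (d := (t + m * n).toNNReal) ?_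
    rw [Real.coe_toNNReal _ (by positivity)]
    intro h0
    obtain ⟨i, hi⟩ := exists_ae_mem_approxAt (Nat.le_add_left 1 m) hn
    let φ : (Fin (m + 1) → Fin n → ℝ) → (Fin n → ℝ) × (Fin m → Fin n → ℝ) :=
      fun X => (X i, fun k => X (i.succAbove k))
    have hφ : LipschitzWith 1 φ := LipschitzWith.of_dist_le_mul fun X X' => by
      rw [NNReal.coe_one, one_mul, Prod.dist_eq]
      exact max_le (dist_le_pi_dist X X' i)
        ((dist_pi_le_iff dist_nonneg).2 fun k => dist_le_pi_dist X X' _)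
    have himg : μH[t + m * n] (φ '' Wv (m + 1) n v) = 0 := by
      refine le_antisymm ((hφ.hausdorffMeasure_image_le (by positivity) _).trans ?_) zero_le
      rw [h0, mul_zero]
    have hslice := hausdorffMeasure_slice_eq_zero (volume : Measure (Fin m → Fin n → ℝ))
      (k := ((m * n : ℕ) : ℝ)) (C := (volume (ball (0 : Fin m → Fin n → ℝ) 1)).toReal) ht
      (Nat.cast_nonneg _) (fun Y R hR => ?_) (by push_cast; exact himg)
    · have hae : ∀ᵐ Y : Fin m → Fin n → ℝ, ∀ᵐ x : Fin n → ℝ,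
          (i.insertNth x Y : Fin (m + 1) → Fin n → ℝ) ∈ approxAt (((m + 1 : ℕ) : ℝ) / n) i := by
        have h1 := (volume_preserving_piFinSuccAbove (fun _ : Fin (m + 1) => Fin n → ℝ) i).symm
        exact Measure.ae_ae_of_ae_prod (p := fun z => (i.insertNth z.2 z.1 : Fin (m + 1) → Fin n → ℝ) ∈
          approxAt (((m + 1 : ℕ) : ℝ) / n) i)
          ((h1.comp Measure.measurePreserving_swap).quasiMeasurePreserving.ae hi)
      have hbad : ∀ᵐ Y : Fin m → Fin n → ℝ, Y ∉ ball (fun _ _ => 1 / 2 : Fin m → Fin n → ℝ) (1 / 2) := by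
        filter_upwards [hslice, hae] with Y h1 h2 h3
        refine hausdorffMeasure_fiber_ne_zero hn hv ht htv i (fun k j => ?_) h2
          (measure_mono_null ?_ h1)
        swap
        · exact fun x hx => ⟨_, hx, by simp [φ]⟩
        have h4 := (dist_le_pi_dist (Y k) _ j).trans_lt
          ((dist_le_pi_dist Y (fun _ _ => 1 / 2) k).trans_lt h3)
        rw [Real.dist_eq, abs_lt] at h4
        constructor <;> linarith [h4.1, h4.2]
      exact (isOpen_ball.measure_pos volume (nonempty_ball.2 one_half_pos)).ne'
        (measure_eq_zero_iff_ae_notMem.2 hbad)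
    · rw [Measure.addHaar_closedBall _ _ hR.le, mul_comm, ENNReal.ofReal_mul ENNReal.toReal_nonneg,
        ENNReal.ofReal_toReal measure_ball_lt_top.ne, Real.rpow_natCast]
      simp [Module.finrank_pi_fintype]
  refine le_of_forall_lt fun c hc => ?_
  have hcont : Tendsto (fun t : ℝ => ENNReal.ofReal (t + m * n))
      (𝓝[<] ((((m + 1 : ℕ) : ℝ) + n) / (v + 1))) (𝓝 (ENNReal.ofReal
        ((((m + 1 : ℕ) : ℝ) + n) / (v + 1) + m * n))) :=
    (ENNReal.continuous_ofReal.comp (continuous_add_const _)).continuousWithinAt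
  obtain ⟨t, hct, ht⟩ := ((hcont.eventually (lt_mem_nhds hc)).and (Ioo_mem_nhdsLT hd)).exists
  exact hct.trans_le (key t ht.1 ht.2)

theorem summable_supNorm_rpow {m : ℕ} (hm : 1 ≤ m) {β : ℝ} (hβ : (m : ℝ) < β) :
    Summable fun q : Fin m → ℤ => (supNorm q : ℝ) ^ (-β) := by
  let b := Pi.basisFun ℝ (Fin m)
  let L := Submodule.span ℤ (Set.range b)
  have hmem : ∀ q : Fin m → ℤ, (fun i => (q i : ℝ)) ∈ L := fun q =>
    (b.mem_span_iff_repr_mem ℤ _).2 fun i => ⟨q i, by simp [b]⟩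
  have hrank : Module.finrank ℤ L = m := by
    rw [ZLattice.rank ℝ L]
    simp
  have hsum := ZLattice.summable_norm_rpow L (-β) (by rw [hrank]; linarith)
  have hinj : Function.Injective fun q : Fin m → ℤ => (⟨_, hmem q⟩ : L) := fun q q' h => by
    ext i
    exact Int.cast_injective (congrFun (Subtype.ext_iff.1 h) i)
  refine (hsum.comp_injective hinj).congr fun q => ?_
  have hnorm : ‖(⟨_, hmem q⟩ : L)‖ = supNorm q := by
    rw [Submodule.coe_norm]
    refine le_antisymm ((pi_norm_le_iff_of_nonneg (Nat.cast_nonneg _)).2 fun i =>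
      abs_le_supNorm q i) ?_
    obtain ⟨i, hi⟩ := exists_supNorm_eq hm q
    rw [hi, Nat.cast_natAbs, Int.cast_abs]
    exact norm_le_pi_norm (fun i => (q i : ℝ)) i
  simp only [Function.comp_apply, hnorm]

/-- The Hausdorff–Cantelli lemma. -/
theorem hausdorffMeasure_infinite_eq_zero {X β : Type*} [EMetricSpace X] [MeasurableSpace X]
    [BorelSpace X] [Countable β] {s : ℝ} (hs : 0 < s) (E : β → Set X)
    (hE : ∑' b, ediam (E b) ^ s ≠ ∞) : μH[s] {x | {b | x ∈ E b}.Infinite} = 0 := by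
  have hlim := ENNReal.tendsto_tsum_compl_atTop_zero hE
  have hlim' : Tendsto (fun F : Finset β => (∑' b : {x // x ∉ F}, ediam (E b) ^ s) ^ s⁻¹) atTop
      (𝓝 0) := by
    have := hlim.ennrpow_const s⁻¹
    rwa [ENNReal.zero_rpow_of_pos (inv_pos.2 hs)] at this
  refine le_antisymm ((Measure.hausdorffMeasure_le_liminf_tsum s _ _ hlim'
    (fun (F : Finset β) (b : {x // x ∉ F}) => E b) (Eventually.of_forall fun F b => ?_)
    (Eventually.of_forall fun F x hx => ?_)).trans hlim.liminf_eq.le) zero_le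
  · rw [ENNReal.le_rpow_inv_iff hs]
    exact ENNReal.le_tsum b
  · obtain ⟨b, hb, hbF⟩ := hx.exists_notMem_finset F
    exact mem_iUnion.2 ⟨⟨b, hbF⟩, hb⟩

/-- The part of the neighbourhood of the plane `q X = p` in a cell of a grid in all rows but the
`i`-th. -/
def planePiece {m n : ℕ} (v : ℝ) (i : Fin (m + 1)) (q : Fin (m + 1) → ℤ) (p : Fin n → ℤ) (L : ℕ)
    (a : Fin m → Fin n → ℕ) : Set (Fin (m + 1) → Fin n → ℝ) :=
  {X | q ≠ 0 ∧ (∀ j, |∑ k, (q k : ℝ) * X k j - p j| < (supNorm q : ℝ) ^ (-v)) ∧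
    ∀ k j, |X (i.succAbove k) j - a k j / L| ≤ 1 / L}

theorem ediam_planePiece_le {m n : ℕ} {v : ℝ} {i : Fin (m + 1)}
    {q : Fin (m + 1) → ℤ} (hqi : supNorm q = (q i).natAbs) (p : Fin n → ℤ) {L : ℕ}
    (hL : (supNorm q : ℝ) ^ (v + 1) ≤ L) (a : Fin m → Fin n → ℕ) :
    ediam (planePiece v i q p L a) ≤
      ENNReal.ofReal ((2 * m + 2) * (supNorm q : ℝ) ^ (-(v + 1))) := by
  refine ediam_le fun X hX X' hX' => ?_
  have hk : (0 : ℝ) < supNorm q := by exact_mod_cast supNorm_pos hX.1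
  have hk' : (supNorm q : ℝ) = |(q i : ℝ)| := by rw [hqi, Nat.cast_natAbs, Int.cast_abs]
  set k : ℝ := (supNorm q : ℝ)
  set δ : ℝ := k ^ (-(v + 1)) with hδ
  have hδ0 : 0 < δ := by positivity
  have hL' : 1 / (L : ℝ) ≤ δ := by
    rw [hδ, Real.rpow_neg hk.le, ← one_div]
    exact one_div_le_one_div_of_le (by positivity) hL
  have hkδ : k ^ (-v) = k * δ := by
    rw [hδ, show -v = 1 + -(v + 1) by ring, Real.rpow_add hk, Real.rpow_one]
  have hrow : ∀ l j, |X (i.succAbove l) j - X' (i.succAbove l) j| ≤ 2 * δ := fun l j => by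
    have h1 := hX.2.2 l j
    have h2 := hX'.2.2 l j
    rw [abs_le] at h1 h2 ⊢
    constructor <;> linarith [h1.1, h1.2, h2.1, h2.2]
  rw [edist_dist]
  refine ENNReal.ofReal_le_ofReal ((dist_pi_le_iff (by positivity)).2 fun l =>
    (dist_pi_le_iff (by positivity)).2 fun j => ?_)
  rw [Real.dist_eq]
  induction l using Fin.succAboveCases i with
  | x =>
    rw [← mul_le_mul_iff_right₀ hk, hk', ← abs_mul, ← hk']
    have h1 := hX.2.1 j
    have h2 := hX'.2.1 j
    rw [hkδ] at h1 h2
    have h3 : q i * (X i j - X' i j) = (∑ k, (q k : ℝ) * X k j - p j) -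
        (∑ k, (q k : ℝ) * X' k j - p j) -
        ∑ l, (q (i.succAbove l) : ℝ) * (X (i.succAbove l) j - X' (i.succAbove l) j) := by
      rw [Fin.sum_univ_succAbove _ i, Fin.sum_univ_succAbove (fun k => (q k : ℝ) * X' k j) i]
      simp only [mul_sub, Finset.sum_sub_distrib]
      ring
    have h4 : |∑ l, (q (i.succAbove l) : ℝ) * (X (i.succAbove l) j - X' (i.succAbove l) j)| ≤
        m * (k * (2 * δ)) := by
      refine (Finset.abs_sum_le_sum_abs _ _).trans ?_
      calc _ ≤ ∑ l : Fin m, k * (2 * δ) := Finset.sum_le_sum fun l _ => by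
            rw [abs_mul]
            gcongr
            · exact abs_le_supNorm q _
            · exact hrow l j
        _ = _ := by simp
    rw [h3]
    rw [abs_lt] at h1 h2
    rw [abs_le] at h4 ⊢
    constructor <;> linarith [h1.1, h1.2, h2.1, h2.2, h4.1, h4.2]
  | p l =>
    refine (hrow l j).trans ?_
    gcongr
    linarith [(Nat.cast_nonneg m : (0 : ℝ) ≤ m)]

theorem exists_mem_planePiece {m n : ℕ} {v : ℝ} (hv : 0 < v) (i : Fin (m + 1))
    {q : Fin (m + 1) → ℤ} (hq : q ≠ 0) {L : ℕ} (hL : 0 < L) {X : Fin (m + 1) → Fin n → ℝ}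
    (hX : ∀ k j, X k j ∈ Icc (0 : ℝ) 1) {p : Fin n → ℤ}
    (hp : ∀ j, |∑ k, (q k : ℝ) * X k j - p j| < (supNorm q : ℝ) ^ (-v)) :
    (∀ j, |p j| ≤ (m + 2) * supNorm q) ∧
      ∃ a : Fin m → Fin n → ℕ, (∀ k j, a k j ≤ L) ∧ X ∈ planePiece v i q p L a := by
  have hL0 : (0 : ℝ) < L := by exact_mod_cast hL
  have hk : (1 : ℝ) ≤ supNorm q := by exact_mod_cast supNorm_pos hq
  refine ⟨fun j => ?_, fun k j => ⌊X (i.succAbove k) j * L⌋₊, fun k j => ?_, hq, hp,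
    fun k j => ?_⟩
  · have h1 : |∑ k, (q k : ℝ) * X k j| ≤ (m + 1) * supNorm q := by
      refine (Finset.abs_sum_le_sum_abs _ _).trans ?_
      calc _ ≤ ∑ k : Fin (m + 1), (supNorm q : ℝ) * 1 := Finset.sum_le_sum fun k _ => by
            rw [abs_mul, abs_of_nonneg (hX k j).1]
            exact mul_le_mul (abs_le_supNorm q k) (hX k j).2 (hX k j).1 (Nat.cast_nonneg _)
        _ = _ := by simp
    have h2 := hp j
    have h3 : (supNorm q : ℝ) ^ (-v) ≤ 1 := Real.rpow_le_one_of_one_le_of_nonpos hk (by linarith)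
    have h4 : |(p j : ℝ)| ≤ (m + 2) * supNorm q := by
      rw [abs_lt] at h2
      rw [abs_le] at h1 ⊢
      constructor <;> linarith [h1.1, h1.2, h2.1, h2.2]
    exact_mod_cast h4
  · refine Nat.floor_le_of_le ?_
    have := (hX (i.succAbove k) j).2
    nlinarith
  · have h0 : 0 ≤ X (i.succAbove k) j * L := mul_nonneg (hX _ _).1 hL0.le
    rw [← mul_le_mul_iff_left₀ hL0, ← abs_of_pos hL0, ← abs_mul, abs_of_pos hL0, sub_mul,
      div_mul_cancel₀ _ hL0.ne', div_mul_cancel₀ _ hL0.ne', abs_le]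
    constructor <;> linarith [Nat.floor_le h0, Nat.lt_floor_add_one (X (i.succAbove k) j * L)]

theorem card_mul_rpow_le {m n N L : ℕ} {k v s c : ℝ} (hk : 1 ≤ k) (hv : 0 < v) (hc : 0 ≤ c)
    (hN : (N : ℝ) = (m + 2) * k) (hL : (L : ℝ) ≤ k ^ (v + 1) + 1) :
    ((2 * N + 1 : ℕ) : ℝ) ^ n * (((L + 1 : ℕ) : ℝ) ^ n) ^ m * (c * k ^ (-(v + 1))) ^ s ≤
      (2 * m + 5) ^ n * (3 ^ n) ^ m * c ^ s * k ^ (-((v + 1) * (s - m * n) - n)) := by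
  have hk0 : 0 < k := by linarith
  have h1 : ((2 * N + 1 : ℕ) : ℝ) ≤ (2 * m + 5) * k := by
    push_cast
    rw [hN]
    linarith
  have h2 : ((L + 1 : ℕ) : ℝ) ≤ 3 * k ^ (v + 1) := by
    push_cast
    linarith [Real.one_le_rpow hk (by linarith : 0 ≤ v + 1)]
  calc _ ≤ ((2 * m + 5) * k) ^ n * ((3 * k ^ (v + 1)) ^ n) ^ m * (c * k ^ (-(v + 1))) ^ s := by
        gcongr
    _ = (2 * m + 5) ^ n * (3 ^ n) ^ m * c ^ s *
          (k ^ n * ((k ^ (v + 1)) ^ n) ^ m * (k ^ (-(v + 1))) ^ s) := by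
        rw [Real.mul_rpow hc (by positivity), mul_pow _ k, mul_pow 3, mul_pow (3 ^ n)]
        ring
    _ = _ := by
        rw [← pow_mul (k ^ (v + 1)), ← Real.rpow_natCast k, ← Real.rpow_mul_natCast hk0.le,
          ← Real.rpow_mul hk0.le, ← Real.rpow_add hk0, ← Real.rpow_add hk0]
        congr 2
        push_cast
        ring

theorem hausdorffMeasure_Wv_eq_zero {m n : ℕ} (hn : 1 ≤ n) {v s : ℝ} (hv : 0 < v)
    (hs : (((m + 1 : ℕ) : ℝ) + n) / (v + 1) + m * n < s) : μH[s] (Wv (m + 1) n v) = 0 := by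
  have hv1 : 0 < v + 1 := by linarith
  have hs0 : 0 < s := lt_of_le_of_lt (by positivity) hs
  choose i hi using exists_supNorm_eq (Nat.le_add_left 1 m)
  let N : (Fin (m + 1) → ℤ) → ℕ := fun q => (m + 2) * supNorm q
  let L : (Fin (m + 1) → ℤ) → ℕ := fun q => ⌈(supNorm q : ℝ) ^ (v + 1)⌉₊
  let B : (Fin (m + 1) → ℤ) → Type := fun q =>
    (Fin n → Finset.Icc (-(N q : ℤ)) (N q)) × (Fin m → Fin n → Fin (L q + 1))
  let E : (Σ q, B q) → Set (Fin (m + 1) → Fin n → ℝ) := fun b =>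
    planePiece v (i b.1) b.1 (fun j => b.2.1 j) (L b.1) fun k j => b.2.2 k j
  refine measure_mono_null ?_ (hausdorffMeasure_infinite_eq_zero hs0 E ?_)
  · rintro X ⟨hX, hinf⟩
    refine Infinite.of_image Sigma.fst (hinf.mono ?_)
    rintro q ⟨hq, hqX⟩
    obtain ⟨p, hp⟩ := (supNint_lt_iff hn).1 hqX
    have hL : 0 < L q := Nat.ceil_pos.2
      (Real.rpow_pos_of_pos (by exact_mod_cast supNorm_pos hq) _)
    obtain ⟨hpN, a, ha, hXa⟩ := exists_mem_planePiece hv (i q) hq hL hX hp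
    refine ⟨⟨q, fun j => ⟨p j, ?_⟩, fun k j => ⟨a k j, Nat.lt_succ_of_le (ha k j)⟩⟩, hXa, rfl⟩
    rw [Finset.mem_Icc, ← abs_le]
    exact_mod_cast hpN j
  · have hβ : ((m + 1 : ℕ) : ℝ) < (v + 1) * (s - m * n) - n := by
      have := (div_lt_iff₀ hv1).1 (lt_sub_iff_add_lt.2 hs)
      linarith
    have hsum := ((summable_supNorm_rpow (Nat.le_add_left 1 m) hβ).mul_left
      ((2 * m + 5) ^ n * (3 ^ n) ^ m * ((2 * m + 2 : ℝ)) ^ s)).tsum_ofReal_ne_top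
    rw [ENNReal.tsum_sigma']
    refine ne_top_of_le_ne_top hsum (ENNReal.tsum_le_tsum fun q => ?_)
    rcases eq_or_ne q 0 with rfl | hq
    · refine le_of_eq_of_le ?_ zero_le
      refine ENNReal.tsum_eq_zero.2 fun b => ?_
      simp [E, planePiece, ENNReal.zero_rpow_of_pos hs0]
    · have hk : (1 : ℝ) ≤ supNorm q := by exact_mod_cast supNorm_pos hq
      rw [tsum_fintype]
      refine (Finset.sum_le_card_nsmul _ _ _ fun b _ => ENNReal.rpow_le_rpow
        (ediam_planePiece_le (hi q) _ (Nat.le_ceil _) _) hs0.le).trans ?_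
      rw [ENNReal.ofReal_rpow_of_nonneg (by positivity) hs0.le, nsmul_eq_mul,
        ← ENNReal.ofReal_natCast, ← ENNReal.ofReal_mul (Nat.cast_nonneg _)]
      refine ENNReal.ofReal_le_ofReal ?_
      refine le_of_eq_of_le ?_ (card_mul_rpow_le (N := N q) (L := L q) (n := n) hk hv
        (by positivity) (by simp [N]) (Nat.ceil_lt_add_one (by positivity)).le)
      congr 1
      have h1 : Fintype.card (Finset.Icc (-(N q : ℤ)) (N q)) = 2 * N q + 1 := by
        rw [Fintype.card_coe, Int.card_Icc]
        omega
      simp only [B, Finset.card_univ, Fintype.card_prod, Fintype.card_pi, h1, Fintype.card_fin,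
        Finset.prod_const]
      push_cast
      rfl

theorem dimH_Wv_of_lt {m n : ℕ} (hm : 1 ≤ m) (hn : 1 ≤ n) {v : ℝ} (hv : (m : ℝ) / n < v) :
    dimH (Wv m n v) =
      ENNReal.ofReal (((m : ℝ) - 1) * (n : ℝ) + ((m : ℝ) + (n : ℝ)) / (v + 1)) := by
  obtain ⟨m, rfl⟩ := Nat.exists_eq_add_of_le' hm
  have hv0 : 0 < v := lt_of_le_of_lt (by positivity) hv
  rw [show ((m + 1 : ℕ) : ℝ) - 1 = m by push_cast; ring, add_comm (_ * _)]
  refine le_antisymm ?_ (le_dimH_Wv hn hv)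
  refine le_of_forall_gt fun c hc => ?_
  rcases eq_or_ne c ∞ with rfl | hc'
  · refine lt_of_le_of_lt (dimH_mono (subset_univ _)) ?_
    rw [Real.dimH_univ_eq_finrank]
    exact ENNReal.natCast_lt_top _
  obtain ⟨s, hs, hsc⟩ := ENNReal.lt_iff_exists_nnreal_btwn.1 hc
  refine lt_of_le_of_lt (dimH_le_of_hausdorffMeasure_ne_top (d := s) ?_) hsc
  rw [← ENNReal.ofReal_coe_nnreal] at hs
  rw [hausdorffMeasure_Wv_eq_zero hn hv0 ((ENNReal.ofReal_lt_ofReal_iff_of_nonneg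
    (by positivity)).1 hs)]
  exact ENNReal.zero_ne_top

theorem dimH_rational_approximation {v : ℝ} (hv : 1 < v) :
    dimH {α : ℝ | α ∈ Icc (0 : ℝ) 1 ∧
        {q : ℕ | 0 < q ∧ nint ((q : ℝ) * α) < (q : ℝ) ^ (-v)}.Infinite} =
      ENNReal.ofReal (2 / (v + 1)) := by
  have h := dimH_Wv_of_lt le_rfl le_rfl (v := v) (m := 1) (n := 1) (by simpa using hv)
  have hι : Isometry fun (α : ℝ) (_ _ : Fin 1) => α := Isometry.of_dist_eq fun a b => by
    rw [dist_pi_const, dist_pi_const]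
  rw [← hι.dimH_image, show (2 : ℝ) / (v + 1) = (((1 : ℕ) : ℝ) - 1) * ((1 : ℕ) : ℝ) +
    (((1 : ℕ) : ℝ) + ((1 : ℕ) : ℝ)) / (v + 1) by norm_num, ← h]
  congr 1
  have hkey : ∀ α : ℝ, {q : ℕ | 0 < q ∧ nint ((q : ℝ) * α) < (q : ℝ) ^ (-v)}.Infinite ↔
      {q : Fin 1 → ℤ | q ≠ 0 ∧
        supNint (fun _ : Fin 1 => ∑ i, (q i : ℝ) * α) < (supNorm q : ℝ) ^ (-v)}.Infinite := by
    intro α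
    have hq : ∀ q : Fin 1 → ℤ, supNorm q = (q 0).natAbs := fun q => by
      obtain ⟨i, hi⟩ := exists_supNorm_eq le_rfl q
      rw [hi, Subsingleton.elim i 0]
    constructor
    · rw [infinite_iff_supNorm]
      intro hinf K
      obtain ⟨k, ⟨hk, hkα⟩, hKk⟩ := hinf.exists_gt K
      have hnorm : supNorm (fun _ : Fin 1 => (k : ℤ)) = k := by simp [hq]
      refine ⟨fun _ => k, ⟨fun h0 => ?_, ?_⟩, hnorm.symm ▸ hKk.le⟩
      · have := congrFun h0 0
        simp only [Pi.zero_apply] at this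
        omega
      · obtain ⟨p, hp⟩ := nint_lt_iff.1 hkα
        rw [hnorm]
        exact (supNint_lt_iff le_rfl).2 ⟨fun _ => p, fun _ => by simpa using hp⟩
    · intro hinf
      rw [infinite_iff_supNorm] at hinf
      refine Set.infinite_of_forall_exists_gt fun K => ?_
      obtain ⟨q, ⟨-, hqα⟩, hK⟩ := hinf (K + 1)
      refine ⟨supNorm q, ⟨by omega, nint_lt_iff.2 ?_⟩, by omega⟩
      obtain ⟨p, hp⟩ := (supNint_lt_iff le_rfl).1 hqα
      have hp0 := hp 0
      rw [Fin.sum_univ_one] at hp0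
      have h1 : ((supNorm q : ℕ) : ℝ) = |(q 0 : ℝ)| := by
        rw [hq, Nat.cast_natAbs, Int.cast_abs]
      rw [h1] at hp0 ⊢
      rcases abs_choice (q 0 : ℝ) with h2 | h2
      · exact ⟨p 0, by rwa [h2] at hp0 ⊢⟩
      · refine ⟨-p 0, ?_⟩
        rw [h2] at hp0 ⊢
        rwa [Int.cast_neg, neg_mul, sub_neg_eq_add, neg_add_eq_sub, abs_sub_comm]
  ext X
  constructor
  · rintro ⟨α, ⟨hα, hinf⟩, rfl⟩
    exact ⟨fun _ _ => hα, (hkey α).1 hinf⟩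
  · rintro ⟨hX, hinf⟩
    have hXc : X = fun _ _ => X 0 0 := by
      ext i j
      rw [Subsingleton.elim i 0, Subsingleton.elim j 0]
    refine ⟨X 0 0, ⟨hX 0 0, (hkey _).2 ?_⟩, hXc.symm⟩
    rw [hXc] at hinf
    exact hinf

end

/-- **Jarník–Besicovitch theorem for linear forms**: for `v > m/n` the
Hausdorff dimension of `W_v` is `(m-1)n + (m+n)/(v+1)`, while for
`v ≤ m/n` it is `mn`. In particular, for `m = n = 1` and `v > 1` the set of
`α ∈ [0,1]` with `‖qα‖ < q^{-v}` for infinitely many `q ∈ ℕ` has Hausdorff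
dimension `2/(v+1)`. -/
theorem dimH_Wv (m n : ℕ) (hm : 1 ≤ m) (hn : 1 ≤ n) (v : ℝ) (hv : 0 < v) :
    ((m : ℝ) / (n : ℝ) < v →
      dimH (Wv m n v) =
        ENNReal.ofReal (((m : ℝ) - 1) * (n : ℝ) + ((m : ℝ) + (n : ℝ)) / (v + 1))) ∧
    (v ≤ (m : ℝ) / (n : ℝ) → dimH (Wv m n v) = ((m * n : ℕ) : ENNReal)) ∧
    (1 < v →
      dimH {α : ℝ | α ∈ Icc (0 : ℝ) 1 ∧
          {q : ℕ | 0 < q ∧ nint ((q : ℝ) * α) < (q : ℝ) ^ (-v)}.Infinite} =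
        ENNReal.ofReal (2 / (v + 1))) := by
  exact ⟨dimH_Wv_of_lt hm hn, dimH_Wv_of_le hm hn, dimH_rational_approximation⟩
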